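/- arXiv:1309.5884 — 9 statements merged into one kernel-verified Lean document; each statement's English description precedes it below -/
import Mathlib

section
/- Let (X,d) be an Hadamard space. Then for all x, y, z, w ∈ X the quadruple inequality d(x,y)² + d(z,w)² ≤ d(x,z)² + d(x,w)² + d(y,z)² + d(y,w)² holds. -/
/-- In an Hadamard space (a complete metric space in which every pair of
points admits a midpoint satisfying the CAT(0) midpoint comparison inequality), the
quadruple inequality
`d(x,y)² + d(z,w)² ≤ d(x,z)² + d(x,w)² + d(y,z)² + d(y,w)²` holds. -/
theorem quadruple_inequality {X : Type*} [MetricSpace X] [CompleteSpace X]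
    (hmid : ∀ x y : X, ∃ m : X, ∀ z : X,
      dist z m ^ 2 ≤ (1/2) * dist z x ^ 2 + (1/2) * dist z y ^ 2 - (1/4) * dist x y ^ 2)
    (x y z w : X) :
    dist x y ^ 2 + dist z w ^ 2 ≤
      dist x z ^ 2 + dist x w ^ 2 + dist y z ^ 2 + dist y w ^ 2 := by
  obtain ⟨m, hm⟩ := hmid x y
  obtain ⟨n, hn⟩ := hmid z w
  have hz := hm z
  have hw := hm w
  have hmn := hn m
  rw [dist_comm m z, dist_comm m w] at hmn
  rw [dist_comm x z, dist_comm x w, dist_comm y z, dist_comm y w]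
  linarith [sq_nonneg (dist m n)]
end

section
/- Let (X,d) be an Hadamard space and f : X → ℝ ∪ {+∞} proper, convex and lower semicontinuous. If y = Prox_f(x), then for all z ∈ X one has f(y) ≤ f(z) + (1/2)d(x,z)² − (1/2)d(x,y)² − (1/2)d(y,z)². -/
open Set

/-- Let `X` be an Hadamard space (complete metric space with geodesics `G`
satisfying the CAT(0) comparison inequality) and `f : X → ℝ ∪ {+∞}` (modelled as
`f : X → EReal` never taking the value `⊥`) be proper, convex and lower semicontinuous.
If `y = Prox_f x`, i.e. `y` minimizes `z ↦ f z + (1/2) d(x,z)²`, then for all `z`,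
`f(y) ≤ f(z) + (1/2)d(x,z)² − (1/2)d(x,y)² − (1/2)d(y,z)²`. -/
theorem prox_fval {X : Type*} [MetricSpace X] [CompleteSpace X]
    (G : X → X → ℝ → X)
    (hG0 : ∀ x y, G x y 0 = x) (hG1 : ∀ x y, G x y 1 = y)
    (hGd : ∀ x y, ∀ s ∈ Icc (0:ℝ) 1, ∀ t ∈ Icc (0:ℝ) 1,
      dist (G x y s) (G x y t) = |s - t| * dist x y)
    (hcmp : ∀ x y z : X, ∀ l ∈ Icc (0:ℝ) 1,
      dist z (G x y l) ^ 2 ≤ (1 - l) * dist z x ^ 2 + l * dist z y ^ 2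
        - l * (1 - l) * dist x y ^ 2)
    (f : X → EReal)
    (hproper : ∃ x, f x ≠ ⊤) (hbot : ∀ x, f x ≠ ⊥)
    (hconv : ∀ x y : X, ∀ l ∈ Icc (0:ℝ) 1,
      f (G x y l) ≤ ((1 - l : ℝ) : EReal) * f x + ((l : ℝ) : EReal) * f y)
    (hlsc : LowerSemicontinuous f)
    (x y : X)
    (hy : ∀ z : X, f y + (((1/2) * dist x y ^ 2 : ℝ) : EReal)
      ≤ f z + (((1/2) * dist x z ^ 2 : ℝ) : EReal))
    (z : X) :
    f y ≤ f z + (((1/2) * dist x z ^ 2 - (1/2) * dist x y ^ 2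
      - (1/2) * dist y z ^ 2 : ℝ) : EReal) := by
  by_cases hzt : f z = ⊤
  · rw [hzt, EReal.top_add_coe]
    exact le_top
  have hyt : f y ≠ ⊤ := by
    intro h
    have h1 := hy z
    rw [h, EReal.top_add_coe, top_le_iff] at h1
    exact (EReal.add_lt_top hzt (EReal.coe_ne_top _)).ne h1
  obtain ⟨b, hb⟩ : ∃ b : ℝ, f y = b := ⟨_, (EReal.coe_toReal hyt (hbot y)).symm⟩
  obtain ⟨c, hc⟩ : ∃ c : ℝ, f z = c := ⟨_, (EReal.coe_toReal hzt (hbot z)).symm⟩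
  have key : ∀ l : ℝ, 0 < l → l ≤ 1 →
      b ≤ c + (1/2) * dist x z ^ 2 - (1/2) * dist x y ^ 2
        - (1/2) * (1 - l) * dist y z ^ 2 := by
    intro l hl0 hl1
    have h1 := (hy (G y z l)).trans (add_le_add_left (hconv y z l ⟨hl0.le, hl1⟩) _)
    rw [hb, hc] at h1
    norm_cast at h1
    have h2 := hcmp y z x l ⟨hl0.le, hl1⟩
    refine le_of_mul_le_mul_left ?_ hl0
    linarith
  rw [hb, hc]
  norm_cast
  by_contra! hlt
  set K := b - (c + ((1/2) * dist x z ^ 2 - (1/2) * dist x y ^ 2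
    - (1/2) * dist y z ^ 2)) with hK
  have hK0 : 0 < K := by linarith
  have hD : 0 ≤ dist y z ^ 2 := sq_nonneg _
  have hKD : 0 < K + dist y z ^ 2 := by linarith
  have hl := key (K / (K + dist y z ^ 2)) (div_pos hK0 hKD)
    ((div_le_one hKD).2 (by linarith))
  have hlD : K / (K + dist y z ^ 2) * dist y z ^ 2 ≤ K := by
    rw [div_mul_eq_mul_div, div_le_iff₀ hKD]
    nlinarith
  linarith
end

section
/- Let (X,d) be an Hadamard space and f : X → ℝ ∪ {+∞} proper, convex and lower semicontinuous. Then the proximal mapping of f is firmly nonexpansive: for all x₁, x₂ ∈ X, setting y₁ = Prox_f(x₁) and y₂ = Prox_f(x₂), one has d(y₁,y₂)² ≤ (1/2)(d(x₁,y₂)² + d(x₂,y₁)² − d(x₁,y₁)² − d(x₂,y₂)²). -/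
open Set

/-- A function minimizing `z ↦ f z + (1/2) d(x,z)²` is finite at the minimizer. -/
theorem prox_ne_top {X : Type*} [MetricSpace X] {f : X → EReal} (hproper : ∃ x, f x ≠ ⊤)
    {x y : X} (hy : ∀ z : X, f y + (((1/2) * dist x y ^ 2 : ℝ) : EReal)
      ≤ f z + (((1/2) * dist x z ^ 2 : ℝ) : EReal)) : f y ≠ ⊤ := by
  obtain ⟨w, hw⟩ := hproper
  intro h
  have h' := hy w
  rw [h, EReal.top_add_coe, top_le_iff] at h'
  exact (EReal.add_lt_top hw (EReal.coe_ne_top _)).ne h'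

/-- The variational inequality for proximal points: if `y` minimizes
`z ↦ f z + (1/2) d(x,z)²`, then `f y + (1/2) d(x,y)² + (1/2) d(y,w)² ≤ f w + (1/2) d(x,w)²`
at every point `w` where `f` is finite. -/
theorem prox_variational_inequality {X : Type*} [MetricSpace X] (G : X → X → ℝ → X)
    (hcmp : ∀ x y z : X, ∀ l ∈ Icc (0:ℝ) 1,
      dist z (G x y l) ^ 2 ≤ (1 - l) * dist z x ^ 2 + l * dist z y ^ 2
        - l * (1 - l) * dist x y ^ 2)
    (f : X → EReal)
    (hconv : ∀ x y : X, ∀ l ∈ Icc (0:ℝ) 1,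
      f (G x y l) ≤ ((1 - l : ℝ) : EReal) * f x + ((l : ℝ) : EReal) * f y)
    {x y w : X} {a b : ℝ} (ha : f y = a) (hb : f w = b)
    (hy : ∀ z : X, f y + (((1/2) * dist x y ^ 2 : ℝ) : EReal)
      ≤ f z + (((1/2) * dist x z ^ 2 : ℝ) : EReal)) :
    a + (1/2) * dist x y ^ 2 + (1/2) * dist y w ^ 2 ≤ b + (1/2) * dist x w ^ 2 := by
  have key : ∀ l ∈ Icc (0:ℝ) 1, a + (1/2) * dist x y ^ 2 ≤
      (1 - l) * a + l * b + (1/2) * dist x (G y w l) ^ 2 := by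
    intro l hl
    have h := (hy (G y w l)).trans (add_le_add_left (hconv y w l hl) _)
    rw [ha, hb] at h
    exact_mod_cast h
  by_contra! hlt
  set C := a + (1/2) * dist x y ^ 2 + (1/2) * dist y w ^ 2 - (b + (1/2) * dist x w ^ 2) with hC
  have hCpos : 0 < C := by linarith
  have hD : 0 ≤ dist y w ^ 2 := sq_nonneg _
  have hS : 0 < C + dist y w ^ 2 := by linarith
  obtain ⟨l, hl⟩ : ∃ l, l = C / (C + dist y w ^ 2) := ⟨_, rfl⟩
  have hl0 : 0 < l := hl ▸ div_pos hCpos hS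
  have hl1 : l ≤ 1 := by rw [hl, div_le_one hS]; linarith
  have hlS : l * (C + dist y w ^ 2) = C := by rw [hl]; field_simp
  have h1 := key l ⟨hl0.le, hl1⟩
  have h2 := hcmp y w x l ⟨hl0.le, hl1⟩
  have h3 : l * C ≤ l * ((1/2) * l * dist y w ^ 2) := by
    rw [hC]; linarith
  have h4 := le_of_mul_le_mul_left h3 hl0
  have h5 : 0 < l * C := mul_pos hl0 hCpos
  linarith

/-- In an Hadamard space, the proximal mapping of a proper, convex, lower
semicontinuous function `f : X → ℝ ∪ {+∞}` is firmly nonexpansive: if `yᵢ = Prox_f xᵢ`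
(i.e. `yᵢ` minimizes `z ↦ f z + (1/2) d(xᵢ,z)²`), then
`d(y₁,y₂)² ≤ (1/2)(d(x₁,y₂)² + d(x₂,y₁)² − d(x₁,y₁)² − d(x₂,y₂)²)`. -/
theorem prox_firmly_nonexpansive {X : Type*} [MetricSpace X] [CompleteSpace X]
    (G : X → X → ℝ → X)
    (hG0 : ∀ x y, G x y 0 = x) (hG1 : ∀ x y, G x y 1 = y)
    (hGd : ∀ x y, ∀ s ∈ Icc (0:ℝ) 1, ∀ t ∈ Icc (0:ℝ) 1,
      dist (G x y s) (G x y t) = |s - t| * dist x y)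
    (hcmp : ∀ x y z : X, ∀ l ∈ Icc (0:ℝ) 1,
      dist z (G x y l) ^ 2 ≤ (1 - l) * dist z x ^ 2 + l * dist z y ^ 2
        - l * (1 - l) * dist x y ^ 2)
    (f : X → EReal)
    (hproper : ∃ x, f x ≠ ⊤) (hbot : ∀ x, f x ≠ ⊥)
    (hconv : ∀ x y : X, ∀ l ∈ Icc (0:ℝ) 1,
      f (G x y l) ≤ ((1 - l : ℝ) : EReal) * f x + ((l : ℝ) : EReal) * f y)
    (hlsc : LowerSemicontinuous f)
    (x₁ x₂ y₁ y₂ : X)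
    (hy₁ : ∀ z : X, f y₁ + (((1/2) * dist x₁ y₁ ^ 2 : ℝ) : EReal)
      ≤ f z + (((1/2) * dist x₁ z ^ 2 : ℝ) : EReal))
    (hy₂ : ∀ z : X, f y₂ + (((1/2) * dist x₂ y₂ ^ 2 : ℝ) : EReal)
      ≤ f z + (((1/2) * dist x₂ z ^ 2 : ℝ) : EReal)) :
    dist y₁ y₂ ^ 2 ≤ (1/2) * (dist x₁ y₂ ^ 2 + dist x₂ y₁ ^ 2
      - dist x₁ y₁ ^ 2 - dist x₂ y₂ ^ 2) := by
  obtain ⟨a, ha⟩ : ∃ a : ℝ, f y₁ = a :=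
    ⟨_, (EReal.coe_toReal (prox_ne_top hproper hy₁) (hbot y₁)).symm⟩
  obtain ⟨b, hb⟩ : ∃ b : ℝ, f y₂ = b :=
    ⟨_, (EReal.coe_toReal (prox_ne_top hproper hy₂) (hbot y₂)).symm⟩
  have h1 := prox_variational_inequality G hcmp f hconv ha hb hy₁
  have h2 := prox_variational_inequality G hcmp f hconv hb ha hy₂
  rw [dist_comm y₂ y₁] at h2
  linarith
end

section
/- Let (X,d) be an Hadamard space and f : X → ℝ ∪ {+∞} proper, lower semicontinuous and uniformly convex with modulus φ. If y = Prox_f(x), then for all z ∈ X one has f(y) ≤ f(z) − φ(d(y,z)) + (1/2)(d(x,z)² − d(x,y)² − d(y,z)²). -/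
open Set

/-- Let `X` be an Hadamard space and `f : X → ℝ ∪ {+∞}` proper, lower
semicontinuous and uniformly convex with modulus `φ : [0,∞) → [0,+∞]` (nondecreasing on
`[0,∞)`, vanishing exactly at `0`). If `y = Prox_f x`, then for all `z`,
`f(y) ≤ f(z) − φ(d(y,z)) + (1/2)(d(x,z)² − d(x,y)² − d(y,z)²)`, stated equivalently
without `EReal` subtraction as
`f(y) + φ(d(y,z)) ≤ f(z) + (1/2)(d(x,z)² − d(x,y)² − d(y,z)²)`. -/
theorem prox_fval_uniformly_convex {X : Type*} [MetricSpace X] [CompleteSpace X]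
    (G : X → X → ℝ → X)
    (hG0 : ∀ x y, G x y 0 = x) (hG1 : ∀ x y, G x y 1 = y)
    (hGd : ∀ x y, ∀ s ∈ Icc (0:ℝ) 1, ∀ t ∈ Icc (0:ℝ) 1,
      dist (G x y s) (G x y t) = |s - t| * dist x y)
    (hcmp : ∀ x y z : X, ∀ l ∈ Icc (0:ℝ) 1,
      dist z (G x y l) ^ 2 ≤ (1 - l) * dist z x ^ 2 + l * dist z y ^ 2
        - l * (1 - l) * dist x y ^ 2)
    (f : X → EReal)
    (hproper : ∃ x, f x ≠ ⊤) (hbot : ∀ x, f x ≠ ⊥)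
    (hlsc : LowerSemicontinuous f)
    (φ : ℝ → EReal)
    (hφ0 : ∀ t ≥ (0:ℝ), 0 ≤ φ t)
    (hφmono : ∀ s t : ℝ, 0 ≤ s → s ≤ t → φ s ≤ φ t)
    (hφeq0 : ∀ t ≥ (0:ℝ), φ t = 0 ↔ t = 0)
    (huconv : ∀ x y : X, ∀ l ∈ Icc (0:ℝ) 1,
      f (G x y l) + ((l * (1 - l) : ℝ) : EReal) * φ (dist x y)
        ≤ ((1 - l : ℝ) : EReal) * f x + ((l : ℝ) : EReal) * f y)
    (x y : X)
    (hy : ∀ z : X, f y + (((1/2) * dist x y ^ 2 : ℝ) : EReal)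
      ≤ f z + (((1/2) * dist x z ^ 2 : ℝ) : EReal))
    (z : X) :
    f y + φ (dist y z)
      ≤ f z + (((1/2) * (dist x z ^ 2 - dist x y ^ 2 - dist y z ^ 2) : ℝ) : EReal) := by
  have hfy : f y ≠ ⊤ := by
    obtain ⟨w, hw⟩ := hproper
    intro h
    have h1 := hy w
    lift f w to ℝ using ⟨hw, hbot w⟩ with b
    rw [h, EReal.top_add_coe, ← EReal.coe_add] at h1
    exact EReal.coe_ne_top _ (top_le_iff.mp h1)
  by_cases hfz : f z = ⊤
  · rw [hfz, EReal.top_add_coe]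
    exact le_top
  obtain ⟨a, ha⟩ : ∃ a : ℝ, f y = a := ⟨_, (EReal.coe_toReal hfy (hbot y)).symm⟩
  obtain ⟨b, hb⟩ : ∃ b : ℝ, f z = b := ⟨_, (EReal.coe_toReal hfz (hbot z)).symm⟩
  have hφbot : φ (dist y z) ≠ ⊥ := fun h => by
    simpa [h] using hφ0 (dist y z) dist_nonneg
  have hφtop : φ (dist y z) ≠ ⊤ := by
    intro h
    have h1 := huconv y z (1 / 2) ⟨by norm_num, by norm_num⟩
    rw [h, ha, hb, EReal.coe_mul_top_of_pos (by norm_num), EReal.add_top_of_ne_bot (hbot _),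
      ← EReal.coe_mul, ← EReal.coe_mul, ← EReal.coe_add] at h1
    exact EReal.coe_ne_top _ (top_le_iff.mp h1)
  obtain ⟨p, hp⟩ : ∃ p : ℝ, φ (dist y z) = p := ⟨_, (EReal.coe_toReal hφtop hφbot).symm⟩
  have hp0 : 0 ≤ p := by
    have := hφ0 (dist y z) dist_nonneg
    rw [hp] at this
    exact_mod_cast this
  have key : ∀ l : ℝ, 0 < l → l < 1 →
      a + p - b - (1 / 2) * (dist x z ^ 2 - dist x y ^ 2 - dist y z ^ 2)
        ≤ l * (p + (1 / 2) * dist y z ^ 2) := by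
    intro l hl0 hl1
    have h1 := huconv y z l ⟨hl0.le, hl1.le⟩
    have h2 := hy (G y z l)
    have h3 := hcmp y z x l ⟨hl0.le, hl1.le⟩
    have hg : f (G y z l) ≠ ⊤ := by
      intro h
      rw [h, hp, ha, hb, ← EReal.coe_mul, EReal.top_add_coe, ← EReal.coe_mul, ← EReal.coe_mul,
        ← EReal.coe_add] at h1
      exact EReal.coe_ne_top _ (top_le_iff.mp h1)
    obtain ⟨g, hg⟩ : ∃ g : ℝ, f (G y z l) = g := ⟨_, (EReal.coe_toReal hg (hbot _)).symm⟩
    rw [hg, hp, ha, hb] at h1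
    rw [hg, ha] at h2
    norm_cast at h1 h2
    refine le_of_mul_le_mul_left ?_ hl0
    linarith
  rw [ha, hb, hp]
  norm_cast
  by_contra! hlt
  set c := a + p - b - (1 / 2) * (dist x z ^ 2 - dist x y ^ 2 - dist y z ^ 2) with hc
  set K := p + (1 / 2) * dist y z ^ 2 with hK
  have hK0 : 0 ≤ K := by positivity
  have hc0 : 0 < c := by linarith
  have hd : 0 < c + K + 1 := by linarith
  have h := key (c / (c + K + 1)) (by positivity) (by rw [div_lt_one hd]; linarith)
  rw [div_mul_eq_mul_div, le_div_iff₀ hd] at h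
  nlinarith
end

section
/- Every bounded sequence in an Hadamard space has a weakly convergent subsequence. -/
open Set Filter Topology

/-- Weak convergence in a geodesic metric space with geodesic map `G`: `u ⇀ x` iff for
every `y`, the metric projections of `u n` onto the geodesic segment `[x,y]`
(i.e. any choice of nearest points on `G x y '' [0,1]`) converge to `x`. -/
def WeakConv {X : Type*} [MetricSpace X] (G : X → X → ℝ → X) (u : ℕ → X) (x : X) : Prop :=
  ∀ y : X, ∀ p : ℕ → X,
    (∀ n, p n ∈ G x y '' Icc (0:ℝ) 1 ∧
      ∀ q ∈ G x y '' Icc (0:ℝ) 1, dist (u n) (p n) ≤ dist (u n) q) →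
    Tendsto p atTop (nhds x)

/-- The asymptotic radius of `u` along the filter `F`. -/
noncomputable def asymptoticRadius {ι X : Type*} [MetricSpace X] (u : ι → X) (F : Filter ι) : ℝ :=
  sInf {r : ℝ | ∃ z, ∀ᶠ n in F, dist (u n) z ≤ r}

section AsymptoticRadius

variable {ι X : Type*} [MetricSpace X] {u : ι → X} {F F' : Filter ι}

theorem nonneg_of_eventually_dist_le [F.NeBot] {z : X} {r : ℝ}
    (h : ∀ᶠ n in F, dist (u n) z ≤ r) : 0 ≤ r :=
  let ⟨_, hn⟩ := h.exists
  dist_nonneg.trans hn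

theorem asymptoticRadius_nonneg [F.NeBot] : 0 ≤ asymptoticRadius u F :=
  Real.sInf_nonneg fun _ ⟨_, hz⟩ => nonneg_of_eventually_dist_le hz

theorem asymptoticRadius_le [F.NeBot] {z : X} {r : ℝ} (h : ∀ᶠ n in F, dist (u n) z ≤ r) :
    asymptoticRadius u F ≤ r :=
  csInf_le ⟨0, fun _ ⟨_, hz⟩ => nonneg_of_eventually_dist_le hz⟩ ⟨z, h⟩

theorem exists_eventually_dist_le [F.NeBot] (hu : Bornology.IsBounded (range u)) {r : ℝ}
    (hr : asymptoticRadius u F < r) : ∃ z, ∀ᶠ n in F, dist (u n) z ≤ r := by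
  obtain ⟨i, -⟩ := F.nonempty_of_mem univ_mem
  obtain ⟨c, hc⟩ := (Metric.isBounded_iff_subset_closedBall (u i)).1 hu
  obtain ⟨s, ⟨z, hz⟩, hs⟩ := exists_lt_of_csInf_lt
    (s := {r : ℝ | ∃ z, ∀ᶠ n in F, dist (u n) z ≤ r})
    ⟨c, u i, .of_forall fun n => hc (mem_range_self n)⟩ hr
  exact ⟨z, hz.mono fun _ hn => hn.trans hs.le⟩

theorem asymptoticRadius_mono [F.NeBot] (hu : Bornology.IsBounded (range u)) (h : F ≤ F') :
    asymptoticRadius u F ≤ asymptoticRadius u F' := by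
  have : F'.NeBot := NeBot.mono ‹_› h
  refine le_of_forall_gt_imp_ge_of_dense fun r hr => ?_
  obtain ⟨z, hz⟩ := exists_eventually_dist_le hu hr
  exact asymptoticRadius_le (h hz)

/-- The quantitative uniqueness of asymptotic centers. -/
theorem dist_sq_le_of_eventually_dist_le [F.NeBot]
    (hmid : ∀ x y : X, ∃ m, ∀ z,
      dist z m ^ 2 ≤ dist z x ^ 2 / 2 + dist z y ^ 2 / 2 - dist x y ^ 2 / 4)
    {z w : X} {r : ℝ} (hz : ∀ᶠ n in F, dist (u n) z ≤ r) (hw : ∀ᶠ n in F, dist (u n) w ≤ r) :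
    dist z w ^ 2 ≤ 4 * (r ^ 2 - asymptoticRadius u F ^ 2) := by
  obtain ⟨m, hm⟩ := hmid z w
  have key : ∀ᶠ n in F, dist (u n) m ^ 2 ≤ r ^ 2 - dist z w ^ 2 / 4 := by
    filter_upwards [hz, hw] with n h1 h2
    have h3 := pow_le_pow_left₀ dist_nonneg h1 2
    have h4 := pow_le_pow_left₀ dist_nonneg h2 2
    linarith [hm (u n)]
  have hpos : 0 ≤ r ^ 2 - dist z w ^ 2 / 4 :=
    let ⟨_, hn⟩ := key.exists
    (sq_nonneg _).trans hn
  have h := asymptoticRadius_le (key.mono fun _ hn => Real.le_sqrt_of_sq_le hn)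
  have := (Real.le_sqrt asymptoticRadius_nonneg hpos).1 h
  linarith

theorem eq_of_eventually_dist_le [F.NeBot]
    (hmid : ∀ x y : X, ∃ m, ∀ z,
      dist z m ^ 2 ≤ dist z x ^ 2 / 2 + dist z y ^ 2 / 2 - dist x y ^ 2 / 4)
    {z w : X} (hz : ∀ ε > 0, ∀ᶠ n in F, dist (u n) z ≤ asymptoticRadius u F + ε)
    (hw : ∀ ε > 0, ∀ᶠ n in F, dist (u n) w ≤ asymptoticRadius u F + ε) : z = w := by
  set R := asymptoticRadius u F
  have hcont : Continuous fun ε : ℝ => 4 * ((R + ε) ^ 2 - R ^ 2) := by fun_prop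
  have hlim := (hcont.tendsto 0).mono_left (nhdsWithin_le_nhds (s := Ioi 0))
  have h : dist z w ^ 2 ≤ 4 * ((R + 0) ^ 2 - R ^ 2) :=
    ge_of_tendsto hlim <| eventually_mem_nhdsWithin.mono fun ε hε =>
      dist_sq_le_of_eventually_dist_le hmid (hz ε hε) (hw ε hε)
  rw [← dist_eq_zero]
  refine pow_eq_zero_iff two_ne_zero |>.1 (le_antisymm ?_ (sq_nonneg _))
  simpa using h

theorem exists_asymptoticCenter [CompleteSpace X] [F.NeBot]
    (hmid : ∀ x y : X, ∃ m, ∀ z,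
      dist z m ^ 2 ≤ dist z x ^ 2 / 2 + dist z y ^ 2 / 2 - dist x y ^ 2 / 4)
    (hu : Bornology.IsBounded (range u)) :
    ∃ x, ∀ ε > 0, ∀ᶠ n in F, dist (u n) x ≤ asymptoticRadius u F + ε := by
  set R := asymptoticRadius u F
  have hε (k : ℕ) : R < R + 1 / ((k : ℝ) + 1) := lt_add_of_pos_right _ Nat.one_div_pos_of_nat
  choose z hz using fun k => exists_eventually_dist_le hu (hε k)
  have hzN {N k : ℕ} (hk : N ≤ k) : ∀ᶠ n in F, dist (u n) (z k) ≤ R + 1 / ((N : ℝ) + 1) :=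
    (hz k).mono fun n hn => hn.trans (by gcongr)
  have hlim : Tendsto (fun N : ℕ => √(4 * ((R + 1 / ((N : ℝ) + 1)) ^ 2 - R ^ 2))) atTop (𝓝 0) := by
    have hcont : Continuous fun ε : ℝ => √(4 * ((R + ε) ^ 2 - R ^ 2)) := by fun_prop
    simpa [Function.comp_def] using
      (hcont.tendsto 0).comp (tendsto_one_div_add_atTop_nhds_zero_nat (𝕜 := ℝ))
  have hcauchy : CauchySeq z := cauchySeq_of_le_tendsto_0 _ (fun j k N hj hk =>
    Real.le_sqrt_of_sq_le (dist_sq_le_of_eventually_dist_le hmid (hzN hj) (hzN hk))) hlim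
  obtain ⟨x, hx⟩ := cauchySeq_tendsto_of_complete hcauchy
  refine ⟨x, fun ε hε => ?_⟩
  obtain ⟨k, hk, hkx⟩ := ((tendsto_one_div_add_atTop_nhds_zero_nat.eventually_lt_const
    (half_pos hε)).and (hx.eventually (Metric.ball_mem_nhds x (half_pos hε)))).exists
  filter_upwards [hz k] with n hn
  have := dist_triangle (u n) (z k) x
  linarith

end AsymptoticRadius

/-- A monotone function bounded below on countably generated proper filters is constant below some
such filter. -/
theorem exists_countablyGenerated_forall_le {ι : Type*} (R : Filter ι → ℝ)
    (hR0 : ∀ F : Filter ι, F.NeBot → 0 ≤ R F)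
    (hR : ∀ F F' : Filter ι, F.NeBot → F ≤ F' → R F ≤ R F')
    (F₀ : Filter ι) [F₀.NeBot] [F₀.IsCountablyGenerated] :
    ∃ F ≤ F₀, F.NeBot ∧ F.IsCountablyGenerated ∧
      ∀ H ≤ F, H.NeBot → H.IsCountablyGenerated → R F ≤ R H := by
  let A := {F : Filter ι // F.NeBot ∧ F.IsCountablyGenerated}
  have step (F : A) (k : ℕ) : ∃ F' : A, F'.1 ≤ F.1 ∧
      ∀ H : A, H.1 ≤ F.1 → R F'.1 ≤ R H.1 + 1 / ((k : ℝ) + 1) := by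
    let S := (fun H : A => R H.1) '' {H | H.1 ≤ F.1}
    have hS : BddBelow S := ⟨0, forall_mem_image.2 fun H _ => hR0 _ H.2.1⟩
    have hlt : sInf S < sInf S + 1 / ((k : ℝ) + 1) :=
      lt_add_of_pos_right _ Nat.one_div_pos_of_nat
    obtain ⟨_, ⟨F', hF', rfl⟩, h⟩ :=
      exists_lt_of_csInf_lt (s := S) ⟨_, F, le_refl F.1, rfl⟩ hlt
    refine ⟨F', hF', fun H hH => h.le.trans ?_⟩
    gcongr
    exact csInf_le hS ⟨H, hH, rfl⟩
  choose next hnext hmin using step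
  let F : ℕ → A := fun k => Nat.rec ⟨F₀, ‹_›, ‹_›⟩ (fun k H => next H k) k
  have hanti : Antitone fun k => (F k).1 := antitone_nat_of_succ_le fun k => hnext (F k) k
  have hne (k : ℕ) : (F k).1.NeBot := (F k).2.1
  have hcg (k : ℕ) : (F k).1.IsCountablyGenerated := (F k).2.2
  have hinf : (⨅ k, (F k).1).NeBot := iInf_neBot_of_directed' hanti.directed_ge hne
  refine ⟨⨅ k, (F k).1, iInf_le _ 0, hinf, inferInstance, fun H hH hHne hHcg => ?_⟩
  have hlim := (tendsto_one_div_add_atTop_nhds_zero_nat (𝕜 := ℝ)).const_add (R H)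
  rw [add_zero] at hlim
  exact ge_of_tendsto' hlim fun k => (hR _ _ hinf (iInf_le _ (k + 1))).trans
    (hmin (F k) k ⟨H, hHne, hHcg⟩ (hH.trans (iInf_le _ k)))

/-- Every bounded sequence in an Hadamard space has a weakly
convergent subsequence. -/
theorem bounded_seq_has_weak_cluster {X : Type*} [MetricSpace X] [CompleteSpace X]
    (G : X → X → ℝ → X)
    (hG0 : ∀ x y, G x y 0 = x) (hG1 : ∀ x y, G x y 1 = y)
    (hGd : ∀ x y, ∀ s ∈ Icc (0:ℝ) 1, ∀ t ∈ Icc (0:ℝ) 1,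
      dist (G x y s) (G x y t) = |s - t| * dist x y)
    (hcmp : ∀ x y z : X, ∀ l ∈ Icc (0:ℝ) 1,
      dist z (G x y l) ^ 2 ≤ (1 - l) * dist z x ^ 2 + l * dist z y ^ 2
        - l * (1 - l) * dist x y ^ 2)
    (u : ℕ → X) (hu : Bornology.IsBounded (Set.range u)) :
    ∃ φ : ℕ → ℕ, StrictMono φ ∧ ∃ x : X, WeakConv G (u ∘ φ) x := by
  have hmid : ∀ x y : X, ∃ m, ∀ z,
      dist z m ^ 2 ≤ dist z x ^ 2 / 2 + dist z y ^ 2 / 2 - dist x y ^ 2 / 4 := fun x y =>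
    ⟨G x y (1 / 2), fun z => by linarith [hcmp x y z (1 / 2) ⟨by norm_num, by norm_num⟩]⟩
  obtain ⟨F, hF, hne, hcg, hmin⟩ := exists_countablyGenerated_forall_le (asymptoticRadius u)
    (fun _ _ => asymptoticRadius_nonneg) (fun _ _ _ h => asymptoticRadius_mono hu h) atTop
  obtain ⟨x, hx⟩ := exists_asymptoticCenter (F := F) hmid hu
  obtain ⟨ψ, hψ⟩ := exists_seq_tendsto F
  obtain ⟨θ, hθ, hψθ⟩ := strictMono_subseq_of_tendsto_atTop (hψ.mono_right hF)
  refine ⟨ψ ∘ θ, hψθ, x, fun y p hp => tendsto_of_subseq_tendsto fun ns hns => ?_⟩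
  have hcont : ContinuousOn (G x y) (Icc 0 1) :=
    (LipschitzOnWith.of_dist_le_mul (K := nndist x y) fun s hs t ht => by
      rw [hGd x y s hs t ht, Real.dist_eq, coe_nndist, mul_comm]).continuousOn
  obtain ⟨q, -, ms, hms, hq⟩ :=
    (isCompact_Icc.image_of_continuousOn hcont).tendsto_subseq fun n => (hp (ns n)).1
  refine ⟨ms, ?_⟩
  suffices x = q by rwa [this]
  let σ : ℕ → ℕ := ψ ∘ θ ∘ ns ∘ ms
  have hσ : Tendsto σ atTop F :=
    hψ.comp (hθ.tendsto_atTop.comp (hns.comp hms.tendsto_atTop))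
  have hrad : asymptoticRadius u (map σ atTop) = asymptoticRadius u F :=
    (asymptoticRadius_mono hu hσ).antisymm (hmin _ hσ inferInstance inferInstance)
  have hxσ : ∀ ε > 0, ∀ᶠ n in map σ atTop,
      dist (u n) x ≤ asymptoticRadius u (map σ atTop) + ε := fun ε hε => by
    rw [hrad]
    exact hσ (hx ε hε)
  refine eq_of_eventually_dist_le hmid hxσ fun ε hε => ?_
  have hnear := hxσ (ε / 2) (half_pos hε)
  rw [eventually_map] at hnear ⊢
  filter_upwards [hnear, hq.eventually (Metric.ball_mem_nhds q (half_pos hε))] with n h₁ h₂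
  have h₃ : dist (u (σ n)) (p (ns (ms n))) ≤ dist (u (σ n)) x :=
    (hp (ns (ms n))).2 x ⟨0, by simp, hG0 x y⟩
  have h₄ := dist_triangle (u (σ n)) (p (ns (ms n))) q
  have h₅ : dist (p (ns (ms n))) q < ε / 2 := h₂
  linarith
end

section
/- Let (X,d) be an Hadamard space and f : X → ℝ ∪ {+∞} convex and lower semicontinuous. Then f is weakly lower semicontinuous: for every sequence (x_n) in X with x_n ⇀ x ∈ X, one has liminf_{n→∞} f(x_n) ≥ f(x). -/
open Set Filter Topology

/-- In a complete space whose geodesics satisfy the midpoint inequality, a nonempty closed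
convex set contains a nearest point to any given point. -/
theorem exists_nearest_point_of_convex {X : Type*} [MetricSpace X] [CompleteSpace X]
    (G : X → X → ℝ → X)
    (hcmp : ∀ x y z : X, ∀ l ∈ Icc (0:ℝ) 1,
      dist z (G x y l) ^ 2 ≤ (1 - l) * dist z x ^ 2 + l * dist z y ^ 2
        - l * (1 - l) * dist x y ^ 2)
    {C : Set X} (hne : C.Nonempty) (hclosed : IsClosed C)
    (hC : ∀ a ∈ C, ∀ b ∈ C, ∀ l ∈ Icc (0:ℝ) 1, G a b l ∈ C) (x : X) :
    ∃ p ∈ C, ∀ z ∈ C, dist x p ≤ dist x z := by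
  set D := Metric.infDist x C with hD
  have hD0 : 0 ≤ D := Metric.infDist_nonneg
  have hex : ∀ n : ℕ, ∃ s ∈ C, dist x s < D + 1 / ((n : ℝ) + 1) := fun n =>
    (Metric.infDist_lt_iff hne).1 (by have : (0:ℝ) < 1 / ((n : ℝ) + 1) := by positivity
                                      linarith)
  choose s hsC hs using hex
  have hlim : Tendsto (fun n : ℕ => D + 1 / ((n : ℝ) + 1)) atTop (𝓝 D) := by
    simpa using tendsto_one_div_add_atTop_nhds_zero_nat.const_add D
  have hcauchy : CauchySeq s := by
    refine cauchySeq_of_le_tendsto_0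
      (fun N : ℕ => √(4 * ((D + 1 / ((N : ℝ) + 1)) ^ 2 - D ^ 2))) ?_ ?_
    · intro n m N hn hm
      apply Real.le_sqrt_of_sq_le
      have hbound : ∀ k, N ≤ k → dist x (s k) ^ 2 ≤ (D + 1 / ((N : ℝ) + 1)) ^ 2 := by
        intro k hk
        have : 1 / ((k : ℝ) + 1) ≤ 1 / ((N : ℝ) + 1) := Nat.one_div_le_one_div hk
        exact pow_le_pow_left₀ dist_nonneg (by linarith [hs k]) 2
      have hhalf : (1 / 2 : ℝ) ∈ Icc (0:ℝ) 1 := by constructor <;> norm_num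
      have hmid : D ^ 2 ≤ dist x (G (s n) (s m) (1 / 2)) ^ 2 :=
        pow_le_pow_left₀ hD0
          (Metric.infDist_le_dist_of_mem (hC _ (hsC n) _ (hsC m) _ hhalf)) 2
      linarith [hcmp (s n) (s m) x _ hhalf, hbound n hn, hbound m hm]
    · have := (((hlim.pow 2).sub_const (D ^ 2)).const_mul 4).sqrt
      simpa using this
  obtain ⟨p, hp⟩ := cauchySeq_tendsto_of_complete hcauchy
  refine ⟨p, hclosed.mem_of_tendsto hp (Eventually.of_forall hsC), fun z hz => ?_⟩
  have hpD : dist x p ≤ D :=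
    le_of_tendsto_of_tendsto' (tendsto_const_nhds.dist hp) hlim fun n => (hs n).le
  exact hpD.trans (Metric.infDist_le_dist_of_mem hz)

/-- If `p` is a nearest point to `w` in a convex set `C`, then every `z ∈ C` is at least as
close to `p` as to `w`. -/
theorem dist_nearest_point_le {X : Type*} [MetricSpace X]
    (G : X → X → ℝ → X)
    (hcmp : ∀ x y z : X, ∀ l ∈ Icc (0:ℝ) 1,
      dist z (G x y l) ^ 2 ≤ (1 - l) * dist z x ^ 2 + l * dist z y ^ 2
        - l * (1 - l) * dist x y ^ 2)
    {C : Set X} (hC : ∀ a ∈ C, ∀ b ∈ C, ∀ l ∈ Icc (0:ℝ) 1, G a b l ∈ C)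
    {w p z : X} (hp : p ∈ C) (hmin : ∀ q ∈ C, dist w p ≤ dist w q) (hz : z ∈ C) :
    dist z p ≤ dist z w := by
  rw [dist_comm z p, dist_comm z w]
  refine le_of_sq_le_sq ?_ dist_nonneg
  by_contra! hlt
  set A := dist p z ^ 2
  set B := dist w z ^ 2
  have hB : 0 ≤ B := sq_nonneg _
  have hA : 0 < A := hB.trans_lt hlt
  set l := (A - B) / (2 * A) with hl
  have hl0 : 0 < l := div_pos (by linarith) (by linarith)
  have hl1 : l ≤ 1 := (div_le_one (by linarith)).2 (by linarith)
  have hlA : l * A = (A - B) / 2 := by rw [hl]; field_simp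
  have hmem : l ∈ Icc (0:ℝ) 1 := ⟨hl0.le, hl1⟩
  have hle : dist w p ^ 2 ≤ dist w (G p z l) ^ 2 :=
    pow_le_pow_left₀ dist_nonneg (hmin _ (hC p hp z hz l hmem)) 2
  have hineq : 0 ≤ l * (B - A + l * A - dist w p ^ 2) := by
    linarith [hcmp p z w l hmem]
  have := nonneg_of_mul_nonneg_right hineq hl0
  nlinarith [sq_nonneg (dist w p)]

/-- Sublevel sets of a convex function are convex. -/
theorem sublevel_geodesic_mem {X : Type*} (G : X → X → ℝ → X) (f : X → EReal)
    (hconv : ∀ x y : X, ∀ l ∈ Icc (0:ℝ) 1,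
      f (G x y l) ≤ ((1 - l : ℝ) : EReal) * f x + ((l : ℝ) : EReal) * f y) (c : ℝ) :
    ∀ a ∈ {y | f y ≤ c}, ∀ b ∈ {y | f y ≤ c}, ∀ l ∈ Icc (0:ℝ) 1,
      G a b l ∈ {y | f y ≤ c} := by
  intro a ha b hb l hl
  calc f (G a b l) ≤ ((1 - l : ℝ) : EReal) * f a + ((l : ℝ) : EReal) * f b := hconv a b l hl
    _ ≤ ((1 - l : ℝ) : EReal) * c + ((l : ℝ) : EReal) * c :=
        add_le_add
          (mul_le_mul_of_nonneg_left ha (EReal.coe_nonneg.2 (sub_nonneg.2 hl.2)))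
          (mul_le_mul_of_nonneg_left hb (EReal.coe_nonneg.2 hl.1))
    _ = c := by
        rw [← EReal.coe_mul, ← EReal.coe_mul, ← EReal.coe_add]
        congr 1
        ring

/-- A point outside a closed convex set is not the weak limit of a sequence that is frequently
in that set. -/
theorem WeakConv.mem_of_frequently_mem {X : Type*} [MetricSpace X] [CompleteSpace X]
    (G : X → X → ℝ → X)
    (hG0 : ∀ x y, G x y 0 = x) (hG1 : ∀ x y, G x y 1 = y)
    (hGd : ∀ x y, ∀ s ∈ Icc (0:ℝ) 1, ∀ t ∈ Icc (0:ℝ) 1,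
      dist (G x y s) (G x y t) = |s - t| * dist x y)
    (hcmp : ∀ x y z : X, ∀ l ∈ Icc (0:ℝ) 1,
      dist z (G x y l) ^ 2 ≤ (1 - l) * dist z x ^ 2 + l * dist z y ^ 2
        - l * (1 - l) * dist x y ^ 2)
    {C : Set X} (hclosed : IsClosed C)
    (hC : ∀ a ∈ C, ∀ b ∈ C, ∀ l ∈ Icc (0:ℝ) 1, G a b l ∈ C)
    {u : ℕ → X} {x : X} (hux : WeakConv G u x) (hfreq : ∃ᶠ n in atTop, u n ∈ C) :
    x ∈ C := by
  obtain ⟨n₀, hn₀⟩ := hfreq.exists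
  obtain ⟨p, hpC, hp⟩ := exists_nearest_point_of_convex G hcmp ⟨_, hn₀⟩ hclosed hC x
  have hzero : (0:ℝ) ∈ Icc (0:ℝ) 1 := by simp
  have hone : (1:ℝ) ∈ Icc (0:ℝ) 1 := by simp
  have hcont : ContinuousOn (G x p) (Icc (0:ℝ) 1) := by
    refine LipschitzOnWith.continuousOn (K := nndist x p)
      (LipschitzOnWith.of_dist_le_mul fun s hs t ht => ?_)
    rw [hGd x p s hs t ht, coe_nndist, Real.dist_eq, mul_comm]
  have hcompact : IsCompact (G x p '' Icc (0:ℝ) 1) := isCompact_Icc.image_of_continuousOn hcont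
  have hnear : ∀ z ∈ C, ∀ q ∈ G x p '' Icc (0:ℝ) 1, dist z p ≤ dist z q := by
    rintro z hz _ ⟨t, ht, rfl⟩
    refine dist_nearest_point_le G hcmp hC hpC (fun q hq => ?_) hz
    have h0 := hGd x p 0 hzero t ht
    have h1 := hGd x p t ht 1 hone
    rw [hG0, zero_sub, abs_neg, abs_of_nonneg ht.1] at h0
    rw [hG1, abs_sub_comm, abs_of_nonneg (sub_nonneg.2 ht.2)] at h1
    linarith [hp q hq, dist_triangle x (G x p t) q]
  have hproj : ∀ n, ∃ r, (r ∈ G x p '' Icc (0:ℝ) 1 ∧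
      ∀ q ∈ G x p '' Icc (0:ℝ) 1, dist (u n) r ≤ dist (u n) q) ∧ (u n ∈ C → r = p) := by
    intro n
    by_cases hn : u n ∈ C
    · exact ⟨p, ⟨⟨1, hone, hG1 x p⟩, hnear _ hn⟩, fun _ => rfl⟩
    · obtain ⟨r, hr, hmin⟩ := hcompact.exists_isMinOn ⟨_, mem_image_of_mem _ hzero⟩
        (continuous_const.dist continuous_id : Continuous fun q => dist (u n) q).continuousOn
      exact ⟨r, ⟨hr, fun q hq => hmin hq⟩, fun h => absurd h hn⟩
  choose r hr hrp using hproj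
  have hlim := hux p r hr
  have hmem : x ∈ ({p} : Set X) :=
    isClosed_singleton.mem_of_frequently_of_tendsto (hfreq.mono fun n hn => hrp n hn) hlim
  exact mem_singleton_iff.1 hmem ▸ hpC

/-- In an Hadamard space, a convex lower semicontinuous function
`f : X → ℝ ∪ {+∞}` is weakly lower semicontinuous: if `x_n ⇀ x`, then
`liminf f(x_n) ≥ f(x)`. -/
theorem weak_lower_semicontinuous {X : Type*} [MetricSpace X] [CompleteSpace X]
    (G : X → X → ℝ → X)
    (hG0 : ∀ x y, G x y 0 = x) (hG1 : ∀ x y, G x y 1 = y)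
    (hGd : ∀ x y, ∀ s ∈ Icc (0:ℝ) 1, ∀ t ∈ Icc (0:ℝ) 1,
      dist (G x y s) (G x y t) = |s - t| * dist x y)
    (hcmp : ∀ x y z : X, ∀ l ∈ Icc (0:ℝ) 1,
      dist z (G x y l) ^ 2 ≤ (1 - l) * dist z x ^ 2 + l * dist z y ^ 2
        - l * (1 - l) * dist x y ^ 2)
    (f : X → EReal) (hbot : ∀ x, f x ≠ ⊥)
    (hconv : ∀ x y : X, ∀ l ∈ Icc (0:ℝ) 1,
      f (G x y l) ≤ ((1 - l : ℝ) : EReal) * f x + ((l : ℝ) : EReal) * f y)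
    (hlsc : LowerSemicontinuous f)
    (u : ℕ → X) (x : X) (hux : WeakConv G u x) :
    f x ≤ Filter.liminf (fun n => f (u n)) atTop := by
  by_contra! hlt
  obtain ⟨c, hc, hcx⟩ := EReal.lt_iff_exists_real_btwn.1 hlt
  have hfreq : ∃ᶠ n in atTop, u n ∈ {y | f y ≤ c} :=
    (frequently_lt_of_liminf_lt (by isBoundedDefault) hc).mono fun n hn => hn.le
  exact hcx.not_ge (hux.mem_of_frequently_mem G hG0 hG1 hGd hcmp
    (hlsc.isClosed_preimage (c : EReal)) (sublevel_geodesic_mem G f hconv c) hfreq)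
end

section
/- Under the backward-backward setup with summable errors, if the problem of minimizing Φ over X × X has a solution, then the sequence of pairs ((x_n, y_n)) converges weakly in the product Hadamard space X × X to a solution, i.e. to a minimizer of Φ. -/
open Set Filter Topology

/-- The objective `Φ(x,y) = f(x) + g(y) + (1/(2γ)) d(x,y)²` of the backward-backward
splitting problem (with `t` playing the role of `γ > 0`). -/
noncomputable def Phi {X : Type*} [MetricSpace X] (f g : X → EReal) (t : ℝ)
    (x y : X) : EReal :=
  f x + g y + (((1 / (2 * t)) * dist x y ^ 2 : ℝ) : EReal)

/-- The ℓ²-product distance on `X × Y`, which makes the product of two Hadamard spaces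
an Hadamard space. -/
noncomputable def prodDist {X Y : Type*} [MetricSpace X] [MetricSpace Y]
    (p q : X × Y) : ℝ :=
  Real.sqrt (dist p.1 q.1 ^ 2 + dist p.2 q.2 ^ 2)

/-- The componentwise geodesic on `X × Y`. -/
def prodGeo {X Y : Type*} (GX : X → X → ℝ → X) (GY : Y → Y → ℝ → Y)
    (p q : X × Y) (l : ℝ) : X × Y :=
  (GX p.1 q.1 l, GY p.2 q.2 l)

/-- Weak convergence in the product Hadamard space `X × X` (with the ℓ²-product metric
and componentwise geodesics): `u ⇀ z` iff for every `w`, the metric projections of `u n`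
onto the product geodesic segment `[z,w]` converge to `z`. -/
def WeakConvProd {X : Type*} [MetricSpace X] (G : X → X → ℝ → X)
    (u : ℕ → X × X) (z : X × X) : Prop :=
  ∀ w : X × X, ∀ p : ℕ → X × X,
    (∀ n, p n ∈ prodGeo G G z w '' Icc (0:ℝ) 1 ∧
      ∀ q ∈ prodGeo G G z w '' Icc (0:ℝ) 1,
        prodDist (u n) (p n) ≤ prodDist (u n) q) →
    Tendsto (fun n => prodDist (p n) z) atTop (nhds 0)

/-- Every pair of points has a midpoint satisfying the Hadamard (CN) inequality. -/
def MidpointInequality (X : Type*) [MetricSpace X] : Prop :=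
  ∀ x y : X, ∃ m : X, ∀ z : X,
    dist z m ^ 2 ≤ (1/2) * dist z x ^ 2 + (1/2) * dist z y ^ 2 - (1/4) * dist x y ^ 2

/-- `P` satisfies the variational inequality characterizing the proximal map of the function
equal to `F` on `D` and to `+∞` outside `D`. -/
structure ProxInequality {X : Type*} [MetricSpace X] (P : X → X) (D : Set X) (F : X → ℝ) :
    Prop where
  mem : ∀ a, P a ∈ D
  le : ∀ a, ∀ z ∈ D, F (P a) + (1/2) * dist a (P a) ^ 2 + (1/2) * dist (P a) z ^ 2
    ≤ F z + (1/2) * dist a z ^ 2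

/-- The asymptotic form of weak convergence: `z` is strictly asymptotically closer to `x` than
any other point. -/
def AsymptoticallyClosest {X : Type*} [MetricSpace X] (x : ℕ → X) (z : X) : Prop :=
  ∀ w : X, ∀ ε > 0, ∀ᶠ n in atTop,
    dist (x n) z ^ 2 + (1/2) * dist z w ^ 2 ≤ dist (x n) w ^ 2 + ε

section Hadamard

variable {X : Type*} [MetricSpace X]

/-- The quadrilateral inequality: the sum of the squares of the diagonals is at most the sum of
the squares of the sides. -/
theorem MidpointInequality.quadrilateral (hX : MidpointInequality X) (x y b a : X) :
    dist x b ^ 2 + dist y a ^ 2 ≤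
      dist x y ^ 2 + dist y b ^ 2 + dist b a ^ 2 + dist a x ^ 2 := by
  obtain ⟨m, hm⟩ := hX x b
  have h1 := hm y
  have h2 := hm a
  have h3 : dist y a ≤ dist y m + dist a m := dist_triangle_right _ _ _
  have h4 : dist y a ^ 2 ≤ (dist y m + dist a m) ^ 2 := by gcongr
  rw [dist_comm y x] at h1
  rw [dist_comm a b] at h2
  nlinarith [sq_nonneg (dist y m - dist a m)]

theorem ProxInequality.dist_le (hX : MidpointInequality X) {P : X → X} {D : Set X} {F : X → ℝ}
    (hP : ProxInequality P D F) (a b : X) : dist (P a) (P b) ≤ dist a b := by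
  have h1 := hP.le a (P b) (hP.mem b)
  have h2 := hP.le b (P a) (hP.mem a)
  have h3 := hX.quadrilateral a b (P b) (P a)
  rw [dist_comm (P b) (P a)] at h2 h3
  rw [dist_comm (P a) a] at h3
  exact le_of_sq_le_sq (by linarith) dist_nonneg

/-- A continuous function bounded below and uniformly convex at midpoints has a minimizer,
with quadratic growth. -/
theorem exists_minimizer_of_midpoint [CompleteSpace X] [Nonempty X] {φ : X → ℝ}
    (hcont : Continuous φ) (hbdd : ∀ w, 0 ≤ φ w)
    (hmid : ∀ x y, ∃ m, φ m ≤ (1/2) * φ x + (1/2) * φ y - (1/4) * dist x y ^ 2) :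
    ∃ z, ∀ w, φ z + (1/2) * dist z w ^ 2 ≤ φ w := by
  have hB : BddBelow (range φ) := ⟨0, by rintro _ ⟨w, rfl⟩; exact hbdd w⟩
  set I := ⨅ w, φ w with hI
  have hle : ∀ w, I ≤ φ w := fun w => ciInf_le hB w
  have hex : ∀ n : ℕ, ∃ w, φ w < I + (1 / ((n : ℝ) + 1)) := fun n =>
    exists_lt_of_ciInf_lt (lt_add_of_pos_right _ (by positivity))
  choose v hv using hex
  have hlim : Tendsto (fun n => φ (v n)) atTop (𝓝 I) := by
    refine tendsto_of_tendsto_of_tendsto_of_le_of_le tendsto_const_nhds ?_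
      (fun n => hle (v n)) (fun n => (hv n).le)
    simpa using tendsto_const_nhds.add (tendsto_one_div_add_atTop_nhds_zero_nat (𝕜 := ℝ))
  have hdist : ∀ x y, dist x y ^ 2 ≤ 2 * (φ x - I) + 2 * (φ y - I) := by
    intro x y
    obtain ⟨m, hm⟩ := hmid x y
    linarith [hle m]
  have hcauchy : CauchySeq v := by
    rw [Metric.cauchySeq_iff]
    intro ε hε
    have hev : ∀ᶠ n in atTop, φ (v n) < I + ε ^ 2 / 4 :=
      hlim.eventually_lt_const (lt_add_of_pos_right _ (by positivity))
    obtain ⟨N, hN⟩ := eventually_atTop.1 hev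
    refine ⟨N, fun m hm n hn => lt_of_pow_lt_pow_left₀ 2 hε.le ?_⟩
    linarith [hdist (v m) (v n), hN m hm, hN n hn]
  obtain ⟨z, hz⟩ := cauchySeq_tendsto_of_complete hcauchy
  have hzI : φ z = I := tendsto_nhds_unique ((hcont.tendsto z).comp hz) hlim
  refine ⟨z, fun w => ?_⟩
  linarith [hdist z w]

/-- Along an ultrafilter, every bounded sequence has an asymptotic center. -/
theorem exists_asymptotic_center [CompleteSpace X] (hX : MidpointInequality X)
    (U : Ultrafilter ℕ) (x : ℕ → X) {q : X} {C : ℝ} (hC : ∀ n, dist (x n) q ≤ C) :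
    ∃ z, ∃ φ : X → ℝ, (∀ w, Tendsto (fun n => dist (x n) w ^ 2) U (𝓝 (φ w))) ∧
      ∀ w, φ z + (1/2) * dist z w ^ 2 ≤ φ w := by
  have hex : ∀ w, ∃ l, Tendsto (fun n => dist (x n) w) U (𝓝 l) := by
    intro w
    have hmem : ∀ n, dist (x n) w ∈ Icc 0 (C + dist q w) := fun n =>
      ⟨dist_nonneg, (dist_triangle _ q _).trans (by linarith [hC n])⟩
    obtain ⟨l, -, hl⟩ := isCompact_Icc.ultrafilter_le_nhds (U.map fun n => dist (x n) w)
      (le_principal_iff.2 (mem_map.2 (univ_mem' hmem)))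
    exact ⟨l, hl⟩
  choose r hr using hex
  have hlip : LipschitzWith 1 r := by
    refine LipschitzWith.of_le_add fun w w' => ?_
    refine le_of_tendsto_of_tendsto' (hr w) ((hr w').add_const (dist w w')) fun n => ?_
    rw [dist_comm w w']
    exact dist_triangle _ _ _
  have hsq : ∀ w, Tendsto (fun n => dist (x n) w ^ 2) U (𝓝 (r w ^ 2)) := fun w => (hr w).pow 2
  have : Nonempty X := ⟨q⟩
  obtain ⟨z, hz⟩ := exists_minimizer_of_midpoint (φ := fun w => r w ^ 2)
    (hlip.continuous.pow 2) (fun w => sq_nonneg _) (by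
      intro a b
      obtain ⟨m, hm⟩ := hX a b
      refine ⟨m, ?_⟩
      exact le_of_tendsto_of_tendsto' (hsq m)
        ((((hsq a).const_mul (1/2)).add ((hsq b).const_mul (1/2))).sub_const _)
        fun n => hm (x n))
  exact ⟨z, fun w => r w ^ 2, hsq, hz⟩

/-- A nonnegative sequence that increases by at most a summable amount converges. -/
theorem exists_tendsto_of_le_add_summable {a e : ℕ → ℝ} (ha : ∀ n, 0 ≤ a n)
    (hs : Summable e) (he : ∀ n, 0 ≤ e n) (h : ∀ n, a (n + 1) ≤ a n + e n) :
    ∃ l, Tendsto a atTop (𝓝 l) := by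
  have hsum := hs.hasSum.tendsto_sum_nat
  have hanti : Antitone fun n => a n - ∑ i ∈ Finset.range n, e i := by
    refine antitone_nat_of_succ_le fun n => ?_
    rw [Finset.sum_range_succ]
    linarith [h n]
  have hbdd : BddBelow (range fun n => a n - ∑ i ∈ Finset.range n, e i) := by
    refine ⟨-∑' i, e i, ?_⟩
    rintro _ ⟨n, rfl⟩
    have := hs.sum_le_tsum (Finset.range n) fun i _ => he i
    dsimp only
    linarith [ha n]
  refine ⟨_, ((tendsto_atTop_ciInf hanti hbdd).add hsum).congr fun n => ?_⟩
  ring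

/-- Distances of an inexact iteration of a nonexpansive map to a fixed point converge. -/
theorem exists_tendsto_dist_of_isFixedPt {T : X → X} (hT : ∀ a b, dist (T a) (T b) ≤ dist a b)
    {x : ℕ → X} (hx : Summable fun n => dist (x (n + 1)) (T (x n))) {p : X} (hp : T p = p) :
    ∃ l, Tendsto (fun n => dist (x n) p) atTop (𝓝 l) := by
  refine exists_tendsto_of_le_add_summable (fun _ => dist_nonneg) hx (fun _ => dist_nonneg) ?_
  intro n
  have h1 := dist_triangle (x (n + 1)) (T (x n)) p
  have h2 := hT (x n) p
  rw [hp] at h2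
  linarith

/-- An inexact iteration with summable errors stays close to the exact one. -/
theorem dist_iterate_le_sum {T : X → X} (hT : ∀ a b, dist (T a) (T b) ≤ dist a b)
    (x : ℕ → X) (m k : ℕ) :
    dist (x (k + m)) (T^[k] (x m)) ≤
      ∑ i ∈ Finset.range k, dist (x (i + m + 1)) (T (x (i + m))) := by
  induction k with
  | zero => simp
  | succ k ih =>
    rw [Finset.sum_range_succ, Function.iterate_succ_apply']
    have h1 := dist_triangle (x (k + 1 + m)) (T (x (k + m))) (T (T^[k] (x m)))
    have h2 := hT (x (k + m)) (T^[k] (x m))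
    have h3 : k + 1 + m = k + m + 1 := by ring
    rw [h3] at h1 ⊢
    linarith

/-- Asymptotic regularity of the exact iteration passes to inexact iterations with summable
errors. -/
theorem tendsto_dist_of_asymptoticallyRegular {T : X → X}
    (hT : ∀ a b, dist (T a) (T b) ≤ dist a b)
    (hreg : ∀ u, Tendsto (fun k => dist (T^[k] u) (T^[k + 1] u)) atTop (𝓝 0))
    {x : ℕ → X} (hx : Summable fun n => dist (x (n + 1)) (T (x n))) :
    Tendsto (fun n => dist (x n) (T (x n))) atTop (𝓝 0) := by
  have htail := tendsto_sum_nat_add fun n => dist (x (n + 1)) (T (x n))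
  rw [Metric.tendsto_atTop]
  intro ε hε
  obtain ⟨m, hm⟩ := (htail.eventually_lt_const (show (0 : ℝ) < ε / 4 by positivity)).exists
  obtain ⟨K, hK⟩ := eventually_atTop.1
    ((hreg (x m)).eventually_lt_const (show (0 : ℝ) < ε / 4 by positivity))
  refine ⟨K + m, fun n hn => ?_⟩
  obtain ⟨k, rfl⟩ : ∃ k, n = k + m := ⟨n - m, by omega⟩
  have h1 := dist_iterate_le_sum hT x m k
  have h2 := ((summable_nat_add_iff m).2 hx).sum_le_tsum (Finset.range k)
    fun i _ => dist_nonneg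
  have h3 := hK k (by omega)
  have h4 := hT (T^[k] (x m)) (x (k + m))
  rw [Function.iterate_succ_apply'] at h3
  rw [dist_comm _ (x (k + m))] at h4
  have h5 := dist_triangle4 (x (k + m)) (T^[k] (x m)) (T (T^[k] (x m))) (T (x (k + m)))
  rw [Real.dist_0_eq_abs, abs_of_nonneg dist_nonneg]
  linarith

/-- Opial-type theorem: an inexact iteration of an asymptotically regular nonexpansive map with
a fixed point converges to a fixed point in the asymptotic sense. -/
theorem exists_asymptoticallyClosest_fixedPt [CompleteSpace X] (hX : MidpointInequality X)
    {T : X → X} (hT : ∀ a b, dist (T a) (T b) ≤ dist a b)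
    (hreg : ∀ u, Tendsto (fun k => dist (T^[k] u) (T^[k + 1] u)) atTop (𝓝 0))
    (hfix : ∃ q, T q = q)
    {x : ℕ → X} (hx : Summable fun n => dist (x (n + 1)) (T (x n))) :
    ∃ z, T z = z ∧ AsymptoticallyClosest x z := by
  obtain ⟨q, hq⟩ := hfix
  obtain ⟨l, hl⟩ := exists_tendsto_dist_of_isFixedPt hT hx hq
  obtain ⟨C, hC⟩ := hl.bddAbove_range
  have hTx := tendsto_dist_of_asymptoticallyRegular hT hreg hx
  have hcenter : ∀ U : Ultrafilter ℕ, (U : Filter ℕ) ≤ atTop → ∃ z, T z = z ∧ ∃ φ : X → ℝ,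
      (∀ w, Tendsto (fun n => dist (x n) w ^ 2) U (𝓝 (φ w))) ∧
      ∀ w, φ z + (1/2) * dist z w ^ 2 ≤ φ w := by
    intro U hU
    obtain ⟨z, φ, hφ, hz⟩ := exists_asymptotic_center hX U x fun n => hC ⟨n, rfl⟩
    refine ⟨z, ?_, φ, hφ, hz⟩
    have hr : Tendsto (fun n => dist (x n) z) U (𝓝 √(φ z)) := by
      simpa [Real.sqrt_sq dist_nonneg] using (hφ z).sqrt
    have h0 : 0 ≤ φ z := ge_of_tendsto' (hφ z) fun n => sq_nonneg _
    have hle : φ (T z) ≤ φ z := by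
      have hlim : Tendsto (fun n => (dist (x n) (T (x n)) + dist (x n) z) ^ 2) U
          (𝓝 ((0 + √(φ z)) ^ 2)) := ((hTx.mono_left hU).add hr).pow 2
      rw [zero_add, Real.sq_sqrt h0] at hlim
      refine le_of_tendsto_of_tendsto' (hφ (T z)) hlim fun n => ?_
      have := dist_triangle (x n) (T (x n)) (T z)
      have := hT (x n) z
      gcongr
      linarith
    have hd : dist z (T z) ^ 2 ≤ 0 := by linarith [hz (T z)]
    exact (dist_eq_zero.1 (pow_eq_zero_iff two_ne_zero |>.1
      (le_antisymm hd (sq_nonneg _)))).symm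
  obtain ⟨z, hzT, φ, hφ, hz⟩ := hcenter (Ultrafilter.of atTop) (Ultrafilter.of_le atTop)
  refine ⟨z, hzT, fun w ε hε => ?_⟩
  by_contra hcon
  have hfreq : ∃ᶠ n in atTop, dist (x n) w ^ 2 + ε < dist (x n) z ^ 2 + (1/2) * dist z w ^ 2 :=
    (not_eventually.1 hcon).mono fun n hn => not_le.1 hn
  obtain ⟨V, hVtop, hVset⟩ : ∃ V : Ultrafilter ℕ, (V : Filter ℕ) ≤ atTop ∧
      ∀ᶠ n in (V : Filter ℕ),
        dist (x n) w ^ 2 + ε < dist (x n) z ^ 2 + (1/2) * dist z w ^ 2 := by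
    obtain ⟨V, hV⟩ := exists_ultrafilter_iff.2 (frequently_mem_iff_neBot.1 hfreq)
    exact ⟨V, hV.trans inf_le_left, le_principal_iff.1 (hV.trans inf_le_right)⟩
  obtain ⟨z', hzT', φ', hφ', hz'⟩ := hcenter V hVtop
  have hagree : ∀ p, T p = p → φ p = φ' p := by
    intro p hp
    obtain ⟨l, hl⟩ := exists_tendsto_dist_of_isFixedPt hT hx hp
    have h1 := tendsto_nhds_unique (hφ p) ((hl.pow 2).mono_left (Ultrafilter.of_le atTop))
    have h2 := tendsto_nhds_unique (hφ' p) ((hl.pow 2).mono_left hVtop)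
    rw [h1, h2]
  have hzz : z' = z := by
    have h1 := hz z'
    have h2 := hz' z
    rw [hagree z hzT, hagree z' hzT', dist_comm] at h1
    have hd : dist z' z ^ 2 ≤ 0 := by linarith
    exact dist_eq_zero.1 (pow_eq_zero_iff two_ne_zero |>.1 (le_antisymm hd (sq_nonneg _)))
  subst hzz
  have := le_of_tendsto_of_tendsto ((hφ' w).add_const ε) ((hφ' z').add_const _)
    (hVset.mono fun n hn => hn.le)
  linarith [hz' w]

/-- Alternating proximal steps are asymptotically regular when the coupled objective is bounded
below. -/
theorem ProxInequality.tendsto_dist_iterate_comp {P Q : X → X} {D E : Set X} {F K : X → ℝ}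
    (hP : ProxInequality P D F) (hQ : ProxInequality Q E K) {c : ℝ}
    (hc : ∀ a ∈ D, ∀ b ∈ E, c ≤ F a + K b + (1/2) * dist a b ^ 2) (u : X) :
    Tendsto (fun k => dist ((P ∘ Q)^[k] u) ((P ∘ Q)^[k + 1] u)) atTop (𝓝 0) := by
  rw [← tendsto_add_atTop_iff_nat 1]
  set v : ℕ → X := fun k => (P ∘ Q)^[k + 1] u with hv
  have hstep : ∀ k, v (k + 1) = P (Q (v k)) := fun k => Function.iterate_succ_apply' _ _ _
  have hmem : ∀ k, v k ∈ D := fun k => by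
    simp only [hv, Function.iterate_succ_apply']
    exact hP.mem _
  set h : ℕ → ℝ := fun k => F (v k) + K (Q (v k)) + (1/2) * dist (v k) (Q (v k)) ^ 2 with hh
  have hdec : ∀ k, h (k + 1) + (1/2) * dist (v k) (v (k + 1)) ^ 2 ≤ h k := by
    intro k
    have h1 := hP.le (Q (v k)) (v k) (hmem k)
    have h2 := hQ.le (v (k + 1)) (Q (v k)) (hQ.mem _)
    rw [← hstep, dist_comm (v (k + 1)) (v k), dist_comm (Q (v k)) (v k)] at h1
    rw [dist_comm (v (k + 1)) (Q (v k))] at h2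
    have := sq_nonneg (dist (Q (v (k + 1))) (Q (v k)))
    simp only [hh]
    linarith
  have hanti : Antitone h := antitone_nat_of_succ_le fun k => by
    linarith [hdec k, sq_nonneg (dist (v k) (v (k + 1)))]
  have hlim := tendsto_atTop_ciInf hanti
    ⟨c, by rintro _ ⟨k, rfl⟩; exact hc _ (hmem k) _ (hQ.mem _)⟩
  have hsq : Tendsto (fun k => dist (v k) (v (k + 1)) ^ 2) atTop (𝓝 0) := by
    have hdiff : Tendsto (fun k => 2 * (h k - h (k + 1))) atTop (𝓝 0) := by
      simpa using (hlim.sub (hlim.comp (tendsto_add_atTop_nat 1))).const_mul 2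
    exact squeeze_zero (fun k => sq_nonneg _) (fun k => by linarith [hdec k]) hdiff
  have hd := hsq.sqrt
  simp only [Real.sqrt_sq dist_nonneg, Real.sqrt_zero] at hd
  exact hd

/-- A pair fixed by alternating proximal steps minimizes the coupled objective. -/
theorem ProxInequality.le_of_fixed (hX : MidpointInequality X) {P Q : X → X} {D E : Set X}
    {F K : X → ℝ} (hP : ProxInequality P D F) (hQ : ProxInequality Q E K) {p q : X}
    (hp : P q = p) (hq : Q p = q) {a b : X} (ha : a ∈ D) (hb : b ∈ E) :
    F p + K q + (1/2) * dist p q ^ 2 ≤ F a + K b + (1/2) * dist a b ^ 2 := by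
  have h1 := hP.le q a ha
  have h2 := hQ.le p b hb
  have h3 := hX.quadrilateral p q b a
  rw [hp, dist_comm q p] at h1
  rw [hq] at h2
  rw [dist_comm b a, dist_comm a p] at h3
  linarith

/-- Inexact alternating proximal steps converge, in the asymptotic sense, to a pair fixed by the
exact steps. -/
theorem ProxInequality.exists_asymptoticallyClosest [CompleteSpace X]
    (hX : MidpointInequality X) {P Q : X → X} {D E : Set X} {F K : X → ℝ}
    (hP : ProxInequality P D F) (hQ : ProxInequality Q E K) {p₀ q₀ : X}
    (hp₀ : P q₀ = p₀) (hq₀ : Q p₀ = q₀) {x y : ℕ → X}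
    (hy : Summable fun n => dist (y n) (Q (x n)))
    (hx : Summable fun n => dist (x (n + 1)) (P (y n))) :
    ∃ p q, P q = p ∧ Q p = q ∧ AsymptoticallyClosest x p ∧ AsymptoticallyClosest y q := by
  have hPn := hP.dist_le hX
  have hQn := hQ.dist_le hX
  have hxT : Summable fun n => dist (x (n + 1)) ((P ∘ Q) (x n)) := by
    refine (hx.add hy).of_nonneg_of_le (fun _ => dist_nonneg) fun n => ?_
    have := dist_triangle (x (n + 1)) (P (y n)) (P (Q (x n)))
    have := hPn (y n) (Q (x n))
    simp only [Function.comp_apply]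
    linarith
  have hyT : Summable fun n => dist (y (n + 1)) ((Q ∘ P) (y n)) := by
    refine (((summable_nat_add_iff 1).2 hy).add hx).of_nonneg_of_le
      (fun _ => dist_nonneg) fun n => ?_
    have := dist_triangle (y (n + 1)) (Q (x (n + 1))) (Q (P (y n)))
    have := hQn (x (n + 1)) (P (y n))
    simp only [Function.comp_apply]
    linarith
  have hTn : ∀ a b, dist ((P ∘ Q) a) ((P ∘ Q) b) ≤ dist a b :=
    fun a b => (hPn _ _).trans (hQn _ _)
  have hSn : ∀ a b, dist ((Q ∘ P) a) ((Q ∘ P) b) ≤ dist a b :=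
    fun a b => (hQn _ _).trans (hPn _ _)
  obtain ⟨p, hp, hpx⟩ := exists_asymptoticallyClosest_fixedPt hX hTn
    (hP.tendsto_dist_iterate_comp hQ (fun a ha b hb => hP.le_of_fixed hX hQ hp₀ hq₀ ha hb))
    ⟨p₀, by simp [hq₀, hp₀]⟩ hxT
  obtain ⟨q, hq, hqy⟩ := exists_asymptoticallyClosest_fixedPt hX hSn
    (hQ.tendsto_dist_iterate_comp hP (fun a ha b hb => hQ.le_of_fixed hX hP hq₀ hp₀ ha hb))
    ⟨q₀, by simp [hq₀, hp₀]⟩ hyT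
  obtain ⟨l, hl⟩ := exists_tendsto_dist_of_isFixedPt hTn hxT hp
  obtain ⟨r, hr⟩ := exists_tendsto_dist_of_isFixedPt hSn hyT hq
  simp only [Function.comp_apply] at hp hq
  have hx0 := hx.tendsto_atTop_zero
  have hy0 := hy.tendsto_atTop_zero
  have hrl : r ^ 2 ≤ l ^ 2 := by
    refine le_of_forall_pos_le_add fun ε hε => ?_
    have hlim : Tendsto (fun n => (dist (y n) (Q (x n)) + dist (x n) p) ^ 2 + ε) atTop
        (𝓝 ((0 + l) ^ 2 + ε)) := ((hy0.add hl).pow 2).add_const ε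
    rw [zero_add] at hlim
    refine le_of_tendsto_of_tendsto (hr.pow 2) hlim ?_
    filter_upwards [hqy (Q p) ε hε] with n hn
    have h1 := dist_triangle (y n) (Q (x n)) (Q p)
    have h2 := hQn (x n) p
    have h3 : dist (y n) (Q p) ^ 2 ≤ (dist (y n) (Q (x n)) + dist (x n) p) ^ 2 := by
      gcongr
      linarith
    linarith [sq_nonneg (dist q (Q p))]
  have hlr : l ^ 2 + (1/2) * dist p (P q) ^ 2 ≤ r ^ 2 := by
    refine le_of_forall_pos_le_add fun ε hε => ?_
    have hlim : Tendsto (fun n => (dist (x (n + 1)) (P (y n)) + dist (y n) q) ^ 2 + ε) atTop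
        (𝓝 ((0 + r) ^ 2 + ε)) := ((hx0.add hr).pow 2).add_const ε
    rw [zero_add] at hlim
    refine le_of_tendsto_of_tendsto
      (((hl.comp (tendsto_add_atTop_nat 1)).pow 2).add_const _) hlim ?_
    filter_upwards [(tendsto_add_atTop_nat 1).eventually (hpx (P q) ε hε)] with n hn
    have h1 := dist_triangle (x (n + 1)) (P (y n)) (P q)
    have h2 := hPn (y n) q
    have h3 : dist (x (n + 1)) (P q) ^ 2 ≤
        (dist (x (n + 1)) (P (y n)) + dist (y n) q) ^ 2 := by
      gcongr
      linarith
    simp only [Function.comp_apply]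
    linarith
  have hd : dist p (P q) ^ 2 ≤ 0 := by linarith
  have hpq : p = P q :=
    dist_eq_zero.1 (pow_eq_zero_iff two_ne_zero |>.1 (le_antisymm hd (sq_nonneg _)))
  exact ⟨p, q, hpq.symm, by rw [hpq, hq], hpx, hqy⟩

end Hadamard

section Geodesic

variable {X : Type*} [MetricSpace X] {G : X → X → ℝ → X}

/-- The comparison inequality on an initial piece of a geodesic. -/
theorem geodesic_comparison_initial
    (hG0 : ∀ x y, G x y 0 = x)
    (hGd : ∀ x y, ∀ s ∈ Icc (0:ℝ) 1, ∀ u ∈ Icc (0:ℝ) 1,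
      dist (G x y s) (G x y u) = |s - u| * dist x y)
    (hcmp : ∀ x y z : X, ∀ l ∈ Icc (0:ℝ) 1,
      dist z (G x y l) ^ 2 ≤ (1 - l) * dist z x ^ 2 + l * dist z y ^ 2
        - l * (1 - l) * dist x y ^ 2)
    (x y z : X) {m l : ℝ} (hm : 0 ≤ m) (hml : m ≤ l) (hl0 : 0 < l) (hl : l ≤ 1) :
    l * dist z (G x y m) ^ 2 ≤ (l - m) * dist z x ^ 2 + m * dist z (G x y l) ^ 2
      - m * (l - m) * l * dist x y ^ 2 := by
  have hmI : m ∈ Icc (0:ℝ) 1 := ⟨hm, hml.trans hl⟩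
  have hlI : l ∈ Icc (0:ℝ) 1 := ⟨hl0.le, hl⟩
  have hdm : dist (G x y m) x = m * dist x y := by
    have := hGd x y m hmI 0 ⟨le_rfl, zero_le_one⟩
    rwa [hG0, sub_zero, abs_of_nonneg hm] at this
  have hdl : dist x (G x y l) = l * dist x y := by
    have := hGd x y l hlI 0 ⟨le_rfl, zero_le_one⟩
    rwa [hG0, sub_zero, abs_of_nonneg hl0.le, dist_comm] at this
  have hdml : dist (G x y m) (G x y l) = (l - m) * dist x y := by
    rw [hGd x y m hmI l hlI, abs_sub_comm, abs_of_nonneg (sub_nonneg.2 hml)]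
  obtain ⟨s, rfl⟩ : ∃ s, m = s * l := ⟨m / l, by field_simp⟩
  have hsI : s ∈ Icc (0:ℝ) 1 :=
    ⟨nonneg_of_mul_nonneg_left hm hl0, by
      by_contra hs
      nlinarith [not_le.1 hs]⟩
  have heq : G x y (s * l) = G x (G x y l) s := by
    have h := hcmp x (G x y l) (G x y (s * l)) s hsI
    rw [hdm, hdl, hdml] at h
    have hd : dist (G x y (s * l)) (G x (G x y l) s) ^ 2 ≤ 0 := by
      refine h.trans (le_of_eq ?_)
      ring
    exact dist_eq_zero.1 (pow_eq_zero_iff two_ne_zero |>.1 (le_antisymm hd (sq_nonneg _)))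
  have h := hcmp x (G x y l) z s hsI
  rw [← heq, hdl] at h
  have := mul_le_mul_of_nonneg_left h hl0.le
  linarith

theorem midpointInequality_of_geodesic
    (hcmp : ∀ x y z : X, ∀ l ∈ Icc (0:ℝ) 1,
      dist z (G x y l) ^ 2 ≤ (1 - l) * dist z x ^ 2 + l * dist z y ^ 2
        - l * (1 - l) * dist x y ^ 2) : MidpointInequality X := fun x y =>
  ⟨G x y (1/2), fun z => by linarith [hcmp x y z (1/2) ⟨by norm_num, by norm_num⟩]⟩

theorem prodDist_sq (p q : X × X) :
    prodDist p q ^ 2 = dist p.1 q.1 ^ 2 + dist p.2 q.2 ^ 2 :=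
  Real.sq_sqrt (by positivity)

theorem prodDist_prodGeo_left
    (hG0 : ∀ x y, G x y 0 = x)
    (hGd : ∀ x y, ∀ s ∈ Icc (0:ℝ) 1, ∀ u ∈ Icc (0:ℝ) 1,
      dist (G x y s) (G x y u) = |s - u| * dist x y)
    (z w : X × X) {l : ℝ} (hl : l ∈ Icc (0:ℝ) 1) :
    prodDist (prodGeo G G z w l) z = l * prodDist z w := by
  have h : ∀ a b : X, dist (G a b l) a = l * dist a b := fun a b => by
    have := hGd a b l hl 0 ⟨le_rfl, zero_le_one⟩
    rwa [hG0, sub_zero, abs_of_nonneg hl.1] at this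
  simp only [prodDist, prodGeo, h]
  rw [← Real.sqrt_sq hl.1, ← Real.sqrt_mul (sq_nonneg _), Real.sqrt_sq hl.1]
  congr 1
  ring

/-- Componentwise asymptotic convergence implies weak convergence in the product. -/
theorem AsymptoticallyClosest.weakConvProd
    (hG0 : ∀ x y, G x y 0 = x)
    (hGd : ∀ x y, ∀ s ∈ Icc (0:ℝ) 1, ∀ u ∈ Icc (0:ℝ) 1,
      dist (G x y s) (G x y u) = |s - u| * dist x y)
    (hcmp : ∀ x y z : X, ∀ l ∈ Icc (0:ℝ) 1,
      dist z (G x y l) ^ 2 ≤ (1 - l) * dist z x ^ 2 + l * dist z y ^ 2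
        - l * (1 - l) * dist x y ^ 2)
    {x y : ℕ → X} {p q : X} (hx : AsymptoticallyClosest x p) (hy : AsymptoticallyClosest y q) :
    WeakConvProd G (fun n => (x n, y n)) (p, q) := by
  intro w r hr
  choose hmem hmin using hr
  choose l hl hlr using hmem
  set d := prodDist (p, q) w with hd
  have hd0 : 0 ≤ d := Real.sqrt_nonneg _
  have hdsq : d ^ 2 = dist p w.1 ^ 2 + dist q w.2 ^ 2 := prodDist_sq _ _
  have hdist : ∀ n, prodDist (r n) (p, q) = l n * d := fun n => by
    rw [← hlr n, prodDist_prodGeo_left hG0 hGd _ _ (hl n)]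
  simp only [hdist]
  rcases hd0.eq_or_lt with h0 | hpos
  · simp [← h0]
  have hl0 : Tendsto l atTop (𝓝 0) := by
    rw [Metric.tendsto_nhds]
    intro ε hε
    set m := min 1 (ε / 2) with hm
    have hm0 : 0 < m := lt_min one_pos (by positivity)
    have hmε : 2 * m ≤ ε := by linarith [min_le_right 1 (ε / 2)]
    have hδ : 0 < m ^ 2 * d ^ 2 / 4 := by positivity
    filter_upwards [hx (G p w.1 m) _ hδ, hy (G q w.2 m) _ hδ] with n h1 h2
    rw [Real.dist_0_eq_abs, abs_of_nonneg (hl n).1]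
    refine lt_of_lt_of_le ?_ hmε
    by_contra! hcon
    have hln : 0 < l n := by linarith
    have e1 := geodesic_comparison_initial hG0 hGd hcmp p w.1 (x n) hm0.le
      (by linarith) hln (hl n).2
    have e2 := geodesic_comparison_initial hG0 hGd hcmp q w.2 (y n) hm0.le
      (by linarith) hln (hl n).2
    have hproj : prodDist (x n, y n) (r n) ≤ prodDist (x n, y n) (p, q) := by
      refine hmin n _ ⟨0, ⟨le_rfl, zero_le_one⟩, ?_⟩
      simp [prodGeo, hG0]
    have e3 : prodDist (x n, y n) (r n) ^ 2 ≤ prodDist (x n, y n) (p, q) ^ 2 :=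
      pow_le_pow_left₀ (Real.sqrt_nonneg _) hproj 2
    rw [prodDist_sq, prodDist_sq, ← hlr n] at e3
    simp only [prodGeo] at e3
    have e4 := mul_le_mul_of_nonneg_left e3 hm0.le
    have e5 : l n * (dist (x n) p ^ 2 + dist (y n) q ^ 2) ≤
        l n * (dist (x n) (G p w.1 m) ^ 2 + dist (y n) (G q w.2 m) ^ 2
          + m ^ 2 * d ^ 2 / 2) := by
      refine mul_le_mul_of_nonneg_left ?_ hln.le
      linarith [sq_nonneg (dist p (G p w.1 m)), sq_nonneg (dist q (G q w.2 m))]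
    have e6 : l n * (m * (l n - m) * d ^ 2) ≤ l n * (m ^ 2 * d ^ 2 / 2) := by
      have : m * (l n - m) * l n * d ^ 2 = m * (l n - m) * l n * dist p w.1 ^ 2
        + m * (l n - m) * l n * dist q w.2 ^ 2 := by rw [hdsq]; ring
      linarith
    have e7 := le_of_mul_le_mul_left e6 hln
    have e8 : m * m * d ^ 2 ≤ m * (l n - m) * d ^ 2 := by
      gcongr
      linarith
    nlinarith
  simpa using hl0.mul_const d

/-- An extended-real-valued minimization property of a proximal map yields its variational
inequality. -/
theorem proxInequality_of_minimizer
    (hcmp : ∀ x y z : X, ∀ l ∈ Icc (0:ℝ) 1,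
      dist z (G x y l) ^ 2 ≤ (1 - l) * dist z x ^ 2 + l * dist z y ^ 2
        - l * (1 - l) * dist x y ^ 2)
    {f : X → EReal} (hproper : ∃ a, f a ≠ ⊤) (hbot : ∀ a, f a ≠ ⊥)
    (hconv : ∀ a b : X, ∀ l ∈ Icc (0:ℝ) 1,
      f (G a b l) ≤ ((1 - l : ℝ) : EReal) * f a + ((l : ℝ) : EReal) * f b)
    {t : ℝ} (ht : 0 < t) {P : X → X}
    (hP : ∀ a z : X,
      ((t : ℝ) : EReal) * f (P a) + (((1/2) * dist a (P a) ^ 2 : ℝ) : EReal)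
        ≤ ((t : ℝ) : EReal) * f z + (((1/2) * dist a z ^ 2 : ℝ) : EReal)) :
    ProxInequality P {a | f a ≠ ⊤} fun a => t * (f a).toReal := by
  have hcoe : ∀ a, f a ≠ ⊤ → f a = ((f a).toReal : EReal) := fun a ha =>
    (EReal.coe_toReal ha (hbot a)).symm
  have hmem : ∀ a, f (P a) ≠ ⊤ := by
    intro a htop
    obtain ⟨z, hz⟩ := hproper
    have h := hP a z
    rw [htop, hcoe z hz, EReal.coe_mul_top_of_pos ht, EReal.top_add_coe, top_le_iff] at h
    exact EReal.coe_ne_top (t * (f z).toReal + (1/2) * dist a z ^ 2) (by exact_mod_cast h)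
  have hreal : ∀ a z, f z ≠ ⊤ → t * (f (P a)).toReal + (1/2) * dist a (P a) ^ 2 ≤
      t * (f z).toReal + (1/2) * dist a z ^ 2 := by
    intro a z hz
    have h := hP a z
    rw [hcoe z hz, hcoe _ (hmem a)] at h
    exact_mod_cast h
  refine ⟨hmem, fun a z hz => ?_⟩
  have hstep : ∀ l ∈ Ioo (0:ℝ) 1, t * (f (P a)).toReal + (1/2) * dist a (P a) ^ 2
      + (1/2) * (1 - l) * dist (P a) z ^ 2 ≤ t * (f z).toReal + (1/2) * dist a z ^ 2 := by
    intro l hl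
    have hlI : l ∈ Icc (0:ℝ) 1 := ⟨hl.1.le, hl.2.le⟩
    have hle := hconv (P a) z l hlI
    rw [hcoe z hz, hcoe _ (hmem a)] at hle
    have hle' : f (G (P a) z l) ≤
        (((1 - l) * (f (P a)).toReal + l * (f z).toReal : ℝ) : EReal) := by
      exact_mod_cast hle
    have hfin : f (G (P a) z l) ≠ ⊤ := ne_top_of_le_ne_top (EReal.coe_ne_top _) hle'
    rw [hcoe _ hfin, EReal.coe_le_coe_iff] at hle'
    have h1 := hreal a _ hfin
    have h2 := hcmp (P a) z a l hlI
    have h3 := mul_le_mul_of_nonneg_left hle' ht.le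
    refine le_of_mul_le_mul_left ?_ hl.1
    linarith
  have hlim : Tendsto (fun l : ℝ => t * (f (P a)).toReal + (1/2) * dist a (P a) ^ 2
      + (1/2) * (1 - l) * dist (P a) z ^ 2) (𝓝[>] 0)
      (𝓝 (t * (f (P a)).toReal + (1/2) * dist a (P a) ^ 2 + (1/2) * dist (P a) z ^ 2)) := by
    have hc : Continuous fun l : ℝ => t * (f (P a)).toReal + (1/2) * dist a (P a) ^ 2
      + (1/2) * (1 - l) * dist (P a) z ^ 2 := by fun_prop
    simpa using (hc.tendsto 0).mono_left nhdsWithin_le_nhds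
  exact le_of_tendsto hlim
    (Filter.eventually_of_mem (Ioo_mem_nhdsGT one_pos) hstep)

/-- Comparing values of `Phi` amounts to comparing the real coupled objectives. -/
theorem Phi_le_Phi_iff {f g : X → EReal} (hfbot : ∀ a, f a ≠ ⊥) (hgbot : ∀ a, g a ≠ ⊥)
    {t : ℝ} (ht : 0 < t) {p q a b : X} (hp : f p ≠ ⊤) (hq : g q ≠ ⊤) (ha : f a ≠ ⊤)
    (hb : g b ≠ ⊤) :
    Phi f g t p q ≤ Phi f g t a b ↔
      t * (f p).toReal + t * (g q).toReal + (1/2) * dist p q ^ 2 ≤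
        t * (f a).toReal + t * (g b).toReal + (1/2) * dist a b ^ 2 := by
  have key : ∀ a b : X, f a ≠ ⊤ → g b ≠ ⊤ → Phi f g t a b =
      (((t * (f a).toReal + t * (g b).toReal + (1/2) * dist a b ^ 2) / t : ℝ) : EReal) := by
    intro a b ha hb
    have : (t * (f a).toReal + t * (g b).toReal + (1/2) * dist a b ^ 2) / t =
        (f a).toReal + (g b).toReal + (1 / (2 * t)) * dist a b ^ 2 := by
      field_simp
    rw [this, EReal.coe_add, EReal.coe_add, EReal.coe_toReal ha (hfbot a),
      EReal.coe_toReal hb (hgbot b)]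
    rfl
  rw [key p q hp hq, key a b ha hb, EReal.coe_le_coe_iff, div_le_div_iff_of_pos_right ht]

theorem Phi_ne_top_iff {f g : X → EReal} (hfbot : ∀ a, f a ≠ ⊥) (hgbot : ∀ a, g a ≠ ⊥)
    {t : ℝ} {a b : X} : Phi f g t a b ≠ ⊤ ↔ f a ≠ ⊤ ∧ g b ≠ ⊤ := by
  rw [Phi, EReal.add_ne_top_iff_of_ne_bot_of_ne_top (EReal.coe_ne_bot _) (EReal.coe_ne_top _),
    EReal.add_ne_top_iff_ne_top₂ (hfbot a) (hgbot b)]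

end Geodesic

/-- Backward-backward setup with summable errors: if `Φ` has a
minimizer over `X × X`, then `((x_n, y_n))` converges weakly in the product Hadamard
space `X × X` to a minimizer of `Φ`. -/
theorem bb_weak_convergence
    {X : Type*} [MetricSpace X] [CompleteSpace X]
    (G : X → X → ℝ → X)
    (hG0 : ∀ x y, G x y 0 = x) (hG1 : ∀ x y, G x y 1 = y)
    (hGd : ∀ x y, ∀ s ∈ Icc (0:ℝ) 1, ∀ u ∈ Icc (0:ℝ) 1,
      dist (G x y s) (G x y u) = |s - u| * dist x y)
    (hcmp : ∀ x y z : X, ∀ l ∈ Icc (0:ℝ) 1,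
      dist z (G x y l) ^ 2 ≤ (1 - l) * dist z x ^ 2 + l * dist z y ^ 2
        - l * (1 - l) * dist x y ^ 2)
    (f g : X → EReal)
    (hfproper : ∃ a, f a ≠ ⊤) (hfbot : ∀ a, f a ≠ ⊥)
    (hfconv : ∀ a b : X, ∀ l ∈ Icc (0:ℝ) 1,
      f (G a b l) ≤ ((1 - l : ℝ) : EReal) * f a + ((l : ℝ) : EReal) * f b)
    (hflsc : LowerSemicontinuous f)
    (hgproper : ∃ a, g a ≠ ⊤) (hgbot : ∀ a, g a ≠ ⊥)
    (hgconv : ∀ a b : X, ∀ l ∈ Icc (0:ℝ) 1,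
      g (G a b l) ≤ ((1 - l : ℝ) : EReal) * g a + ((l : ℝ) : EReal) * g b)
    (hglsc : LowerSemicontinuous g)
    (t : ℝ) (ht : 0 < t)
    -- `proxf x = Prox_{t·f}(x)` and `proxg x = Prox_{t·g}(x)`:
    (proxf proxg : X → X)
    (hproxf : ∀ a z : X,
      ((t : ℝ) : EReal) * f (proxf a) + (((1/2) * dist a (proxf a) ^ 2 : ℝ) : EReal)
        ≤ ((t : ℝ) : EReal) * f z + (((1/2) * dist a z ^ 2 : ℝ) : EReal))
    (hproxg : ∀ a z : X,
      ((t : ℝ) : EReal) * g (proxg a) + (((1/2) * dist a (proxg a) ^ 2 : ℝ) : EReal)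
        ≤ ((t : ℝ) : EReal) * g z + (((1/2) * dist a z ^ 2 : ℝ) : EReal))
    (x y : ℕ → X)
    (herr₁ : Summable (fun n => dist (y n) (proxg (x n))))
    (herr₂ : Summable (fun n => dist (x (n + 1)) (proxf (y n))))
    (hsol : ∃ p : X × X, ∀ a b : X, Phi f g t p.1 p.2 ≤ Phi f g t a b) :
    ∃ p : X × X, (∀ a b : X, Phi f g t p.1 p.2 ≤ Phi f g t a b) ∧
      WeakConvProd G (fun n => (x n, y n)) p := by
  have hX := midpointInequality_of_geodesic hcmp
  have hP := proxInequality_of_minimizer hcmp hfproper hfbot hfconv ht hproxf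
  have hQ := proxInequality_of_minimizer hcmp hgproper hgbot hgconv ht hproxg
  obtain ⟨⟨p₀, q₀⟩, hmin⟩ := hsol
  obtain ⟨hp₀, hq₀⟩ : f p₀ ≠ ⊤ ∧ g q₀ ≠ ⊤ := by
    obtain ⟨a, ha⟩ := hfproper
    obtain ⟨b, hb⟩ := hgproper
    rw [← Phi_ne_top_iff hfbot hgbot (t := t)]
    exact ne_top_of_le_ne_top ((Phi_ne_top_iff hfbot hgbot).2 ⟨ha, hb⟩) (hmin a b)
  have hpfix : proxf q₀ = p₀ := by
    have h1 := hP.le q₀ p₀ hp₀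
    have h2 := (Phi_le_Phi_iff hfbot hgbot ht hp₀ hq₀ (hP.mem q₀) hq₀).1 (hmin (proxf q₀) q₀)
    rw [dist_comm p₀ q₀, dist_comm (proxf q₀) q₀] at h2
    have hd : dist (proxf q₀) p₀ ^ 2 ≤ 0 := by linarith
    exact dist_eq_zero.1 (pow_eq_zero_iff two_ne_zero |>.1 (le_antisymm hd (sq_nonneg _)))
  have hqfix : proxg p₀ = q₀ := by
    have h1 := hQ.le p₀ q₀ hq₀
    have h2 := (Phi_le_Phi_iff hfbot hgbot ht hp₀ hq₀ hp₀ (hQ.mem p₀)).1 (hmin p₀ (proxg p₀))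
    have hd : dist (proxg p₀) q₀ ^ 2 ≤ 0 := by linarith
    exact dist_eq_zero.1 (pow_eq_zero_iff two_ne_zero |>.1 (le_antisymm hd (sq_nonneg _)))
  obtain ⟨p, q, hp, hq, hxp, hyq⟩ :=
    hP.exists_asymptoticallyClosest hX hQ hpfix hqfix herr₁ herr₂
  refine ⟨(p, q), fun a b => ?_, hxp.weakConvProd hG0 hGd hcmp hyq⟩
  by_cases hab : Phi f g t a b = ⊤
  · rw [hab]
    exact le_top
  obtain ⟨ha, hb⟩ := (Phi_ne_top_iff hfbot hgbot).1 hab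
  exact (Phi_le_Phi_iff hfbot hgbot ht (hp ▸ hP.mem q) (hq ▸ hQ.mem p) ha hb).2
    (hP.le_of_fixed hX hQ hp hq ha hb)
end

section
/- Under the error-free backward-backward iteration, lim_{n→∞} Φ(x_n, y_n) = lim_{n→∞} Φ(x_{n+1}, y_n) = inf{Φ(x,y) : x, y ∈ X}, where this common value may be −∞; no existence of a minimizer or lower bound on Φ is assumed. -/
open Set Filter Topology

/-- The quadrilateral inequality in a space with midpoints satisfying the CN inequality. -/
theorem dist_sq_add_dist_sq_le_of_midpoint {X : Type*} [MetricSpace X] {a b c d m : X}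
    (hm : ∀ z, dist z m ^ 2
      ≤ (1 / 2) * dist z a ^ 2 + (1 / 2) * dist z c ^ 2 - (1 / 4) * dist a c ^ 2) :
    dist a c ^ 2 + dist b d ^ 2
      ≤ dist a b ^ 2 + dist b c ^ 2 + dist c d ^ 2 + dist d a ^ 2 := by
  have hb := hm b
  have hd := hm d
  have htri : dist b d ≤ dist b m + dist d m := dist_triangle_right b d m
  have hbd : dist b d ^ 2 ≤ 2 * (dist b m ^ 2 + dist d m ^ 2) := by
    nlinarith [sq_nonneg (dist b m - dist d m), dist_nonneg (x := b) (y := d)]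
  rw [dist_comm b a] at hb
  rw [dist_comm d c] at hd
  linarith

theorem le_of_forall_add_one_sub_mul_le {P D Q : ℝ}
    (h : ∀ l : ℝ, 0 < l → l ≤ 1 → P + (1 - l) * D ≤ Q) : P + D ≤ Q := by
  have hlim : Tendsto (fun n : ℕ => P + (1 - 1 / ((n : ℝ) + 1)) * D) atTop
      (𝓝 (P + (1 - 0) * D)) :=
    ((tendsto_one_div_add_atTop_nhds_zero_nat.const_sub 1).mul_const D).const_add P
  have hle := le_of_tendsto' hlim fun n => h (1 / ((n : ℝ) + 1)) (by positivity) (by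
    rw [div_le_one (by positivity)]
    linarith [n.cast_nonneg (α := ℝ)])
  linarith

/-- The three-point inequality for a proximal point `p` of `a`. -/
theorem prox_three_point {X : Type*} [MetricSpace X] (G : X → X → ℝ → X)
    (hcmp : ∀ x y z : X, ∀ l ∈ Icc (0:ℝ) 1,
      dist z (G x y l) ^ 2 ≤ (1 - l) * dist z x ^ 2 + l * dist z y ^ 2
        - l * (1 - l) * dist x y ^ 2)
    {f : X → EReal} (hfbot : ∀ a, f a ≠ ⊥)
    (hfconv : ∀ a b : X, ∀ l ∈ Icc (0:ℝ) 1,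
      f (G a b l) ≤ ((1 - l : ℝ) : EReal) * f a + ((l : ℝ) : EReal) * f b)
    {t : ℝ} (ht : 0 < t) {a p u : X}
    (hp : ∀ z : X,
      ((t : ℝ) : EReal) * f p + (((1/2) * dist a p ^ 2 : ℝ) : EReal)
        ≤ ((t : ℝ) : EReal) * f z + (((1/2) * dist a z ^ 2 : ℝ) : EReal))
    {r s : ℝ} (hr : f p = r) (hs : f u = s) :
    t * r + (1 / 2) * dist a p ^ 2 + (1 / 2) * dist p u ^ 2
      ≤ t * s + (1 / 2) * dist a u ^ 2 := by
  refine le_of_forall_add_one_sub_mul_le fun l hl0 hl1 => ?_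
  have hl : l ∈ Icc (0:ℝ) 1 := ⟨hl0.le, hl1⟩
  have hconv := hfconv p u l hl
  have hmin := hp (G p u l)
  rw [hr, hs] at hconv
  rw [hr] at hmin
  have hconv_top : f (G p u l) ≠ ⊤ :=
    ne_top_of_le_ne_top (EReal.coe_ne_top ((1 - l) * r + l * s)) (by exact_mod_cast hconv)
  lift f (G p u l) to ℝ using ⟨hconv_top, hfbot _⟩ with q
  have hconv_real : q ≤ (1 - l) * r + l * s := by exact_mod_cast hconv
  have hmin_real : t * r + (1/2) * dist a p ^ 2 ≤ t * q + (1/2) * dist a (G p u l) ^ 2 := by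
    exact_mod_cast hmin
  have hdist := hcmp p u a l hl
  have hmul := mul_le_mul_of_nonneg_left hconv_real ht.le
  refine le_of_mul_le_mul_left ?_ hl0
  linarith

theorem prox_ne_top_s17 {X : Type*} [MetricSpace X] {f : X → EReal}
    (hfproper : ∃ a, f a ≠ ⊤) (hfbot : ∀ a, f a ≠ ⊥) {t : ℝ} (ht : 0 < t) {a p : X}
    (hp : ∀ z : X,
      ((t : ℝ) : EReal) * f p + (((1/2) * dist a p ^ 2 : ℝ) : EReal)
        ≤ ((t : ℝ) : EReal) * f z + (((1/2) * dist a z ^ 2 : ℝ) : EReal)) :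
    f p ≠ ⊤ := by
  obtain ⟨z, hz⟩ := hfproper
  intro htop
  have hmin := hp z
  lift f z to ℝ using ⟨hz, hfbot z⟩ with q
  rw [htop, EReal.coe_mul_top_of_pos ht, EReal.top_add_coe, top_le_iff] at hmin
  exact EReal.coe_ne_top (t * q + (1/2) * dist a z ^ 2) (by exact_mod_cast hmin)

theorem Phi_eq_coe {X : Type*} [MetricSpace X] {f g : X → EReal} {t : ℝ} {x y : X} {r s : ℝ}
    (hr : f x = r) (hs : g y = s) :
    Phi f g t x y = ((r + s + (1 / (2 * t)) * dist x y ^ 2 : ℝ) : EReal) := by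
  rw [Phi, hr, hs]
  norm_cast

/-- Real numbers bounded below cannot decrease by a fixed positive amount forever. -/
theorem nonpos_of_forall_le_sub_succ {D : ℕ → ℝ} (hD : ∀ n, 0 ≤ D n) {e : ℝ}
    (h : ∀ n, e ≤ D n - D (n + 1)) : e ≤ 0 := by
  by_contra! he
  obtain ⟨N, hN⟩ := exists_nat_gt (D 0 / e)
  have hsum : ∀ n : ℕ, n * e ≤ D 0 - D n := by
    intro n
    induction n with
    | zero => simp
    | succ k ih =>
      push_cast
      linarith [h k]
  rw [div_lt_iff₀ he] at hN
  linarith [hsum N, hD N]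

/-- Error-free backward-backward iteration: without assuming any
minimizer or lower bound, `lim_n Φ(x_n, y_n) = lim_n Φ(x_{n+1}, y_n)
= inf {Φ(a,b) : a, b ∈ X}` (the common value may be `−∞`). -/
theorem bb_errorfree_values_tendsto_inf
    {X : Type*} [MetricSpace X] [CompleteSpace X]
    (G : X → X → ℝ → X)
    (hG0 : ∀ x y, G x y 0 = x) (hG1 : ∀ x y, G x y 1 = y)
    (hGd : ∀ x y, ∀ s ∈ Icc (0:ℝ) 1, ∀ u ∈ Icc (0:ℝ) 1,
      dist (G x y s) (G x y u) = |s - u| * dist x y)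
    (hcmp : ∀ x y z : X, ∀ l ∈ Icc (0:ℝ) 1,
      dist z (G x y l) ^ 2 ≤ (1 - l) * dist z x ^ 2 + l * dist z y ^ 2
        - l * (1 - l) * dist x y ^ 2)
    (f g : X → EReal)
    (hfproper : ∃ a, f a ≠ ⊤) (hfbot : ∀ a, f a ≠ ⊥)
    (hfconv : ∀ a b : X, ∀ l ∈ Icc (0:ℝ) 1,
      f (G a b l) ≤ ((1 - l : ℝ) : EReal) * f a + ((l : ℝ) : EReal) * f b)
    (hflsc : LowerSemicontinuous f)
    (hgproper : ∃ a, g a ≠ ⊤) (hgbot : ∀ a, g a ≠ ⊥)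
    (hgconv : ∀ a b : X, ∀ l ∈ Icc (0:ℝ) 1,
      g (G a b l) ≤ ((1 - l : ℝ) : EReal) * g a + ((l : ℝ) : EReal) * g b)
    (hglsc : LowerSemicontinuous g)
    (t : ℝ) (ht : 0 < t)
    -- `proxf x = Prox_{t·f}(x)` and `proxg x = Prox_{t·g}(x)`:
    (proxf proxg : X → X)
    (hproxf : ∀ a z : X,
      ((t : ℝ) : EReal) * f (proxf a) + (((1/2) * dist a (proxf a) ^ 2 : ℝ) : EReal)
        ≤ ((t : ℝ) : EReal) * f z + (((1/2) * dist a z ^ 2 : ℝ) : EReal))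
    (hproxg : ∀ a z : X,
      ((t : ℝ) : EReal) * g (proxg a) + (((1/2) * dist a (proxg a) ^ 2 : ℝ) : EReal)
        ≤ ((t : ℝ) : EReal) * g z + (((1/2) * dist a z ^ 2 : ℝ) : EReal))
    (x y : ℕ → X)
    (hy : ∀ n, y n = proxg (x n))
    (hx : ∀ n, x (n + 1) = proxf (y n))
    : Tendsto (fun n => Phi f g t (x n) (y n)) atTop
        (nhds (⨅ p : X × X, Phi f g t p.1 p.2)) ∧
      Tendsto (fun n => Phi f g t (x (n + 1)) (y n)) atTop
        (nhds (⨅ p : X × X, Phi f g t p.1 p.2)) := by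
  have hxtop (n : ℕ) : f (x (n + 1)) ≠ ⊤ := by
    rw [hx]
    exact prox_ne_top_s17 hfproper hfbot ht (hproxf (y n))
  have hytop (n : ℕ) : g (y n) ≠ ⊤ := by
    rw [hy]
    exact prox_ne_top_s17 hgproper hgbot ht (hproxg (x n))
  have hfx (n : ℕ) : f (x (n + 1)) = ((f (x (n + 1))).toReal : EReal) :=
    (EReal.coe_toReal (hxtop n) (hfbot _)).symm
  have hgy (n : ℕ) : g (y n) = ((g (y n)).toReal : EReal) :=
    (EReal.coe_toReal (hytop n) (hgbot _)).symm
  have hproxf' (n : ℕ) (u : X) (r : ℝ) (hr : f u = r) :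
      t * (f (x (n + 1))).toReal + (1 / 2) * dist (y n) (x (n + 1)) ^ 2
        + (1 / 2) * dist (x (n + 1)) u ^ 2 ≤ t * r + (1 / 2) * dist (y n) u ^ 2 :=
    prox_three_point G hcmp hfbot hfconv ht (by rw [hx]; exact hproxf (y n)) (hfx n) hr
  have hproxg' (n : ℕ) (v : X) (s : ℝ) (hs : g v = s) :
      t * (g (y n)).toReal + (1 / 2) * dist (x n) (y n) ^ 2
        + (1 / 2) * dist (y n) v ^ 2 ≤ t * s + (1 / 2) * dist (x n) v ^ 2 :=
    prox_three_point G hcmp hgbot hgconv ht (by rw [hy]; exact hproxg (x n)) (hgy n) hs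
  have hscale {p q d e : ℝ} (h : t * p + (1 / 2) * d ≤ t * q + (1 / 2) * e) :
      p + (1 / (2 * t)) * d ≤ q + (1 / (2 * t)) * e := by
    refine le_of_mul_le_mul_left ?_ ht
    field_simp
    linarith
  have hstep_y (n : ℕ) : Phi f g t (x (n + 1)) (y (n + 1)) ≤ Phi f g t (x (n + 1)) (y n) := by
    rw [Phi_eq_coe (hfx n) (hgy (n + 1)), Phi_eq_coe (hfx n) (hgy n), EReal.coe_le_coe_iff]
    have h := hproxg' (n + 1) (y n) _ (hgy n)
    have := hscale (p := (g (y (n + 1))).toReal) (q := (g (y n)).toReal)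
      (d := dist (x (n + 1)) (y (n + 1)) ^ 2) (e := dist (x (n + 1)) (y n) ^ 2)
      (by linarith [sq_nonneg (dist (y (n + 1)) (y n))])
    linarith
  have hstep_x (n : ℕ) :
      Phi f g t (x (n + 2)) (y (n + 1)) ≤ Phi f g t (x (n + 1)) (y (n + 1)) := by
    rw [Phi_eq_coe (hfx (n + 1)) (hgy (n + 1)), Phi_eq_coe (hfx n) (hgy (n + 1)),
      EReal.coe_le_coe_iff, dist_comm (x (n + 2)), dist_comm (x (n + 1))]
    have h := hproxf' (n + 1) (x (n + 1)) _ (hfx n)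
    have := hscale (p := (f (x (n + 2))).toReal) (q := (f (x (n + 1))).toReal)
      (d := dist (y (n + 1)) (x (n + 2)) ^ 2) (e := dist (y (n + 1)) (x (n + 1)) ^ 2)
      (by linarith [sq_nonneg (dist (x (n + 2)) (x (n + 1)))])
    linarith
  have hanti : Antitone fun n => Phi f g t (x (n + 1)) (y n) :=
    antitone_nat_of_succ_le fun n => (hstep_x n).trans (hstep_y n)
  have hinf : ⨅ n, Phi f g t (x (n + 1)) (y n) = ⨅ p : X × X, Phi f g t p.1 p.2 := by
    refine le_antisymm (le_iInf fun ⟨u, v⟩ => ?_)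
      (le_iInf fun n => iInf_le (fun p : X × X => Phi f g t p.1 p.2) (x (n + 1), y n))
    by_contra! hlt
    by_cases hu : f u = ⊤
    · rw [Phi, hu, EReal.top_add_of_ne_bot (hgbot v), EReal.top_add_coe] at hlt
      exact not_top_lt hlt
    by_cases hv : g v = ⊤
    · rw [Phi, hv, EReal.add_top_of_ne_bot (hfbot u), EReal.top_add_coe] at hlt
      exact not_top_lt hlt
    have hfu : f u = ((f u).toReal : EReal) := (EReal.coe_toReal hu (hfbot u)).symm
    have hgv : g v = ((g v).toReal : EReal) := (EReal.coe_toReal hv (hgbot v)).symm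
    obtain ⟨c, hc, hcinf⟩ := EReal.lt_iff_exists_real_btwn.1 hlt
    rw [Phi_eq_coe hfu hgv, EReal.coe_lt_coe_iff] at hc
    refine absurd (nonpos_of_forall_le_sub_succ
      (D := fun n => (1 / (2 * t)) * dist (x n) u ^ 2) (fun n => by positivity)
      fun n => ?_) (not_le.2 (sub_pos.2 hc))
    have hcn := hcinf.le.trans (iInf_le _ n)
    rw [Phi_eq_coe (hfx n) (hgy n), EReal.coe_le_coe_iff] at hcn
    have hquad := dist_sq_add_dist_sq_le_of_midpoint (a := y n) (b := x n) (c := u) (d := v)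
      (m := G (y n) u (1 / 2)) fun z => by
        linarith [hcmp (y n) u z (1 / 2) ⟨by norm_num, by norm_num⟩]
    rw [dist_comm (y n) (x n), dist_comm v (y n)] at hquad
    have h1 := hproxf' n u _ hfu
    have h2 := hproxg' n v _ hgv
    rw [dist_comm (y n) (x (n + 1))] at h1
    have := hscale (p := (f (x (n + 1))).toReal + (g (y n)).toReal)
      (q := (f u).toReal + (g v).toReal)
      (d := dist (x (n + 1)) (y n) ^ 2)
      (e := dist u v ^ 2 + dist (x n) u ^ 2 - dist (x (n + 1)) u ^ 2) (by linarith)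
    linarith
  have hlim : Tendsto (fun n => Phi f g t (x (n + 1)) (y n)) atTop
      (𝓝 (⨅ p : X × X, Phi f g t p.1 p.2)) := hinf ▸ tendsto_atTop_iInf hanti
  refine ⟨(tendsto_add_atTop_iff_nat 1).1 ?_, hlim⟩
  exact tendsto_of_tendsto_of_tendsto_of_le_of_le tendsto_const_nhds hlim
    (fun n => iInf_le (fun p : X × X => Phi f g t p.1 p.2) (x (n + 1), y (n + 1))) hstep_y
end

section
/- Under the error-free backward-backward iteration, for each solution (x̄, ȳ) of the minimization of Φ over X × X, one has the Fejér-type monotonicity d(x_{n+1}, x̄) ≤ d(y_n, ȳ) ≤ d(x_n, x̄) for all n ≥ 0. -/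
open Set Filter Topology

/-- In a geodesic space satisfying the CAT(0) comparison inequality, the sum of the squared
diagonals of a quadrilateral is at most the sum of its squared sides. -/
theorem dist_sq_add_dist_sq_le_of_comparison {X : Type*} [MetricSpace X] {G : X → X → ℝ → X}
    (hcmp : ∀ x y z : X, ∀ l ∈ Icc (0:ℝ) 1,
      dist z (G x y l) ^ 2 ≤ (1 - l) * dist z x ^ 2 + l * dist z y ^ 2
        - l * (1 - l) * dist x y ^ 2) (a b p q : X) :
    dist a q ^ 2 + dist b p ^ 2 ≤
      dist a b ^ 2 + dist b q ^ 2 + dist p q ^ 2 + dist a p ^ 2 := by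
  have h1 := hcmp b p a (1 / 2) (by norm_num)
  have h2 := hcmp b p q (1 / 2) (by norm_num)
  have h3 := dist_triangle_right a q (G b p (1 / 2))
  rw [dist_comm q b, dist_comm q p] at h2
  have h4 : dist a q ^ 2 ≤ (dist a (G b p (1 / 2)) + dist q (G b p (1 / 2))) ^ 2 := by gcongr
  nlinarith [sq_nonneg (dist a (G b p (1 / 2)) - dist q (G b p (1 / 2)))]

/-- `p` is a proximal point of `t • f` at `a`, expressed through real values of `f` on its
effective domain. -/
def IsProxPoint {X : Type*} [MetricSpace X] (f : X → EReal) (t : ℝ) (a p : X) : Prop :=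
  f p ≠ ⊤ ∧ ∀ z, f z ≠ ⊤ →
    t * (f p).toReal + 1 / 2 * dist a p ^ 2 ≤ t * (f z).toReal + 1 / 2 * dist a z ^ 2

theorem isProxPoint_of_forall_le {X : Type*} [MetricSpace X] {f : X → EReal}
    (hproper : ∃ a, f a ≠ ⊤) (hbot : ∀ a, f a ≠ ⊥) {t : ℝ} (ht : 0 < t) {a p : X}
    (h : ∀ z, ((t : ℝ) : EReal) * f p + (((1/2) * dist a p ^ 2 : ℝ) : EReal)
        ≤ ((t : ℝ) : EReal) * f z + (((1/2) * dist a z ^ 2 : ℝ) : EReal)) :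
    IsProxPoint f t a p := by
  have hp : f p ≠ ⊤ := by
    intro hp
    obtain ⟨w, hw⟩ := hproper
    have hz := h w
    rw [hp, ← EReal.coe_toReal hw (hbot w), EReal.coe_mul_top_of_pos ht, EReal.top_add_coe] at hz
    norm_cast at hz
  refine ⟨hp, fun z hz => ?_⟩
  have h' := h z
  rw [← EReal.coe_toReal hp (hbot p), ← EReal.coe_toReal hz (hbot z)] at h'
  exact_mod_cast h'

theorem IsProxPoint.add_dist_sq_le {X : Type*} [MetricSpace X] {G : X → X → ℝ → X}
    (hcmp : ∀ x y z : X, ∀ l ∈ Icc (0:ℝ) 1,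
      dist z (G x y l) ^ 2 ≤ (1 - l) * dist z x ^ 2 + l * dist z y ^ 2
        - l * (1 - l) * dist x y ^ 2)
    {f : X → EReal} (hbot : ∀ a, f a ≠ ⊥)
    (hconv : ∀ a b : X, ∀ l ∈ Icc (0:ℝ) 1,
      f (G a b l) ≤ ((1 - l : ℝ) : EReal) * f a + ((l : ℝ) : EReal) * f b)
    {t : ℝ} (ht : 0 < t) {a p z : X} (h : IsProxPoint f t a p) (hz : f z ≠ ⊤) :
    t * (f p).toReal + 1 / 2 * dist a p ^ 2 + 1 / 2 * dist p z ^ 2 ≤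
      t * (f z).toReal + 1 / 2 * dist a z ^ 2 := by
  have key : ∀ l ∈ Ioc (0:ℝ) 1,
      t * (f p).toReal + 1 / 2 * dist a p ^ 2 + 1 / 2 * dist p z ^ 2 ≤
        t * (f z).toReal + 1 / 2 * dist a z ^ 2 + l * (1 / 2 * dist p z ^ 2) := by
    intro l hl
    have hl' : l ∈ Icc (0:ℝ) 1 := ⟨hl.1.le, hl.2⟩
    have h1 := hconv p z l hl'
    rw [← EReal.coe_toReal h.1 (hbot p), ← EReal.coe_toReal hz (hbot z)] at h1
    norm_cast at h1
    have hG : f (G p z l) ≠ ⊤ := ne_top_of_le_ne_top (EReal.coe_ne_top _) h1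
    rw [← EReal.coe_toReal hG (hbot _), EReal.coe_le_coe_iff] at h1
    have h2 := h.2 _ hG
    have h3 := hcmp p z a l hl'
    have h4 := mul_le_mul_of_nonneg_left h1 ht.le
    refine le_of_mul_le_mul_left ?_ hl.1
    linarith
  refine le_of_forall_pos_le_add fun ε hε => ?_
  have hD : 0 ≤ 1 / 2 * dist p z ^ 2 := by positivity
  have hpos : 0 < ε + 1 / 2 * dist p z ^ 2 := by positivity
  have hk := key (ε / (ε + 1 / 2 * dist p z ^ 2))
    ⟨by positivity, (div_le_one hpos).2 (by linarith)⟩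
  have : ε / (ε + 1 / 2 * dist p z ^ 2) * (1 / 2 * dist p z ^ 2) ≤ ε := by
    rw [div_mul_eq_mul_div, div_le_iff₀ hpos]
    nlinarith
  linarith

theorem IsProxPoint.dist_le_dist {X : Type*} [MetricSpace X] {G : X → X → ℝ → X}
    (hcmp : ∀ x y z : X, ∀ l ∈ Icc (0:ℝ) 1,
      dist z (G x y l) ^ 2 ≤ (1 - l) * dist z x ^ 2 + l * dist z y ^ 2
        - l * (1 - l) * dist x y ^ 2)
    {f : X → EReal} (hbot : ∀ a, f a ≠ ⊥)
    (hconv : ∀ a b : X, ∀ l ∈ Icc (0:ℝ) 1,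
      f (G a b l) ≤ ((1 - l : ℝ) : EReal) * f a + ((l : ℝ) : EReal) * f b)
    {t : ℝ} (ht : 0 < t) {a b p q : X} (hp : IsProxPoint f t a p) (hq : IsProxPoint f t b q) :
    dist p q ≤ dist a b := by
  have h1 := hp.add_dist_sq_le hcmp hbot hconv ht hq.1
  have h2 := hq.add_dist_sq_le hcmp hbot hconv ht hp.1
  have h3 := dist_sq_add_dist_sq_le_of_comparison hcmp a b p q
  rw [dist_comm q p] at h2
  exact (sq_le_sq₀ dist_nonneg dist_nonneg).1 (by linarith)

/-- The components of a minimizer of `Phi` are proximal points of one another. -/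
theorem isProxPoint_of_forall_Phi_le {X : Type*} [MetricSpace X] {f g : X → EReal}
    (hfproper : ∃ a, f a ≠ ⊤) (hfbot : ∀ a, f a ≠ ⊥)
    (hgproper : ∃ a, g a ≠ ⊤) (hgbot : ∀ a, g a ≠ ⊥)
    {t : ℝ} (ht : 0 < t) {xbar ybar : X}
    (hsol : ∀ a b : X, Phi f g t xbar ybar ≤ Phi f g t a b) :
    IsProxPoint f t ybar xbar ∧ IsProxPoint g t xbar ybar := by
  obtain ⟨u, hu⟩ := hfproper
  obtain ⟨v, hv⟩ := hgproper
  have hfin : Phi f g t xbar ybar ≠ ⊤ :=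
    ne_top_of_le_ne_top
      (EReal.add_ne_top (EReal.add_ne_top hu hv) (EReal.coe_ne_top _)) (hsol u v)
  have hf : f xbar ≠ ⊤ := by
    intro h
    apply hfin
    rw [Phi, h, EReal.top_add_of_ne_bot (hgbot _), EReal.top_add_coe]
  have hg : g ybar ≠ ⊤ := by
    intro h
    apply hfin
    rw [Phi, h, EReal.add_top_of_ne_bot (hfbot _), EReal.top_add_coe]
  have key : ∀ a b, f a ≠ ⊤ → g b ≠ ⊤ →
      t * (f xbar).toReal + t * (g ybar).toReal + 1 / 2 * dist xbar ybar ^ 2 ≤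
        t * (f a).toReal + t * (g b).toReal + 1 / 2 * dist a b ^ 2 := by
    intro a b ha hb
    have h := hsol a b
    rw [Phi, Phi, ← EReal.coe_toReal hf (hfbot _), ← EReal.coe_toReal hg (hgbot _),
      ← EReal.coe_toReal ha (hfbot _), ← EReal.coe_toReal hb (hgbot _)] at h
    norm_cast at h
    have h' := mul_le_mul_of_nonneg_left h ht.le
    have e : ∀ r s D : ℝ, t * (r + s + 1 / (2 * t) * D) = t * r + t * s + 1 / 2 * D := by
      intro r s D
      field_simp
    rwa [e, e] at h'
  refine ⟨⟨hf, fun z hz => ?_⟩, ⟨hg, fun z hz => ?_⟩⟩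
  · have h := key z ybar hz hg
    rw [dist_comm xbar ybar, dist_comm z ybar] at h
    linarith
  · have h := key xbar z hf hz
    linarith

/-- Error-free backward-backward iteration: for every solution
`(x̄, ȳ)` of the minimization of `Φ` over `X × X`, the Fejér-type monotonicity
`d(x_{n+1}, x̄) ≤ d(y_n, ȳ) ≤ d(x_n, x̄)` holds for all `n ≥ 0`. -/
theorem bb_errorfree_fejer
    {X : Type*} [MetricSpace X] [CompleteSpace X]
    (G : X → X → ℝ → X)
    (hG0 : ∀ x y, G x y 0 = x) (hG1 : ∀ x y, G x y 1 = y)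
    (hGd : ∀ x y, ∀ s ∈ Icc (0:ℝ) 1, ∀ u ∈ Icc (0:ℝ) 1,
      dist (G x y s) (G x y u) = |s - u| * dist x y)
    (hcmp : ∀ x y z : X, ∀ l ∈ Icc (0:ℝ) 1,
      dist z (G x y l) ^ 2 ≤ (1 - l) * dist z x ^ 2 + l * dist z y ^ 2
        - l * (1 - l) * dist x y ^ 2)
    (f g : X → EReal)
    (hfproper : ∃ a, f a ≠ ⊤) (hfbot : ∀ a, f a ≠ ⊥)
    (hfconv : ∀ a b : X, ∀ l ∈ Icc (0:ℝ) 1,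
      f (G a b l) ≤ ((1 - l : ℝ) : EReal) * f a + ((l : ℝ) : EReal) * f b)
    (hflsc : LowerSemicontinuous f)
    (hgproper : ∃ a, g a ≠ ⊤) (hgbot : ∀ a, g a ≠ ⊥)
    (hgconv : ∀ a b : X, ∀ l ∈ Icc (0:ℝ) 1,
      g (G a b l) ≤ ((1 - l : ℝ) : EReal) * g a + ((l : ℝ) : EReal) * g b)
    (hglsc : LowerSemicontinuous g)
    (t : ℝ) (ht : 0 < t)
    -- `proxf x = Prox_{t·f}(x)` and `proxg x = Prox_{t·g}(x)`:
    (proxf proxg : X → X)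
    (hproxf : ∀ a z : X,
      ((t : ℝ) : EReal) * f (proxf a) + (((1/2) * dist a (proxf a) ^ 2 : ℝ) : EReal)
        ≤ ((t : ℝ) : EReal) * f z + (((1/2) * dist a z ^ 2 : ℝ) : EReal))
    (hproxg : ∀ a z : X,
      ((t : ℝ) : EReal) * g (proxg a) + (((1/2) * dist a (proxg a) ^ 2 : ℝ) : EReal)
        ≤ ((t : ℝ) : EReal) * g z + (((1/2) * dist a z ^ 2 : ℝ) : EReal))
    (x y : ℕ → X)
    (hy : ∀ n, y n = proxg (x n))
    (hx : ∀ n, x (n + 1) = proxf (y n))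
    (xbar ybar : X)
    (hsol : ∀ a b : X, Phi f g t xbar ybar ≤ Phi f g t a b) :
    ∀ n : ℕ, dist (x (n + 1)) xbar ≤ dist (y n) ybar ∧
      dist (y n) ybar ≤ dist (x n) xbar := by
  intro n
  obtain ⟨hxb, hyb⟩ := isProxPoint_of_forall_Phi_le hfproper hfbot hgproper hgbot ht hsol
  rw [hx n]
  constructor
  · exact (isProxPoint_of_forall_le hfproper hfbot ht (hproxf (y n))).dist_le_dist
      hcmp hfbot hfconv ht hxb
  · rw [hy n]
    exact (isProxPoint_of_forall_le hgproper hgbot ht (hproxg (x n))).dist_le_dist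
      hcmp hgbot hgconv ht hyb
end
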